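/- arXiv:2507.05793 — 2 statements merged into one kernel-verified Lean document; each statement's English description precedes it below -/
import Mathlib

section
/- If a recurrent rooted network (G,c,o) has a unique potential h, then h tends to infinity: for every b>0 the level set {v∈V : h(v)≤b} is finite. -/
open scoped Classical
open Filter Topology MeasureTheory ProbabilityTheory

/-- A weighted network: an infinite, connected, locally finite graph with
positive edge conductances, encoded by a symmetric conductance function. -/
structure Network (V : Type*) where
  c : V → V → ℝ
  symm : ∀ x y, c x y = c y x
  nonneg : ∀ x y, 0 ≤ c x y
  locFin : ∀ x, {y | 0 < c x y}.Finite
  conn : ∀ x y, Relation.ReflTransGen (fun a b => 0 < c a b) x y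
  deg_pos : ∀ x, 0 < ∑' y, c x y
  infinite : Infinite V

namespace Network

variable {V : Type*} (N : Network V)

/-- Total conductance at a vertex. -/
noncomputable def cTot (x : V) : ℝ := ∑' y, N.c x y

/-- One-step transition probabilities of the network random walk. -/
noncomputable def p (x y : V) : ℝ := N.c x y / N.cTot x

/-- `n`-step transition probabilities of the network random walk. -/
noncomputable def pstep : ℕ → V → V → ℝ
  | 0, x, y => if x = y then 1 else 0
  | n + 1, x, y => ∑' z, pstep n x z * N.p z y

/-- The network random walk is recurrent: the expected number of returns is infinite. -/
def Recurrent : Prop := ∀ x : V, ¬ Summable (fun n => N.pstep n x x)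

/-- `avoid A n x y` is the probability that the walk started at `x` is at `y` at time `n`
without having visited the set `A` at any time `0,…,n`, i.e. `P_x(X_n = y, τ_A > n)`. -/
noncomputable def avoid (A : Set V) : ℕ → V → V → ℝ
  | 0, x, y => if x = y ∧ x ∉ A then 1 else 0
  | n + 1, x, y => if y ∈ A then 0 else ∑' z, avoid A n x z * N.p z y

/-- Green kernel of the walk killed at `o`:  `G_o(x,y) = Σ_n P_x(X_n = y, τ_o > n)`. -/
noncomputable def GreenK (o x y : V) : ℝ := ∑' n, N.avoid {o} n x y

/-- Green density of the walk killed at `o`:  `g_o(x,y) = G_o(x,y)/c_y`. -/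
noncomputable def g (o x y : V) : ℝ := N.GreenK o x y / N.cTot y

/-- The network Laplacian `Δf(v) = Σ_x c_{vx}(f(x) − f(v))`. -/
noncomputable def lap (f : V → ℝ) (v : V) : ℝ := ∑' x, N.c v x * (f x - f v)

/-- A potential on the rooted network `(G,c,o)`: a nonnegative function vanishing at `o`,
with Laplacian `1` at `o` and harmonic elsewhere. -/
def IsPotential (o : V) (h : V → ℝ) : Prop :=
  (∀ v, 0 ≤ h v) ∧ h o = 0 ∧ N.lap h o = 1 ∧ ∀ v, v ≠ o → N.lap h v = 0

/-- Harmonic measure from `v` on a set `A`:  `ω_v^A(z) = P_v(X_{τ_A} = z)`. -/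
noncomputable def harm (A : Set V) (v z : V) : ℝ :=
  if v ∈ A then (if v = z then 1 else 0)
  else if z ∈ A then ∑' n, ∑' w, N.avoid A n v w * N.p w z
  else 0

/-- Effective resistance `R_eff(x ↔ y) = g_x(y,y)`. -/
noncomputable def Reff (x y : V) : ℝ := N.g x y y

/-- Transition probabilities of the Doob `h`-transform: `p^h(x,y) = p(x,y) h(y)/h(x)`. -/
noncomputable def ph (h : V → ℝ) (x y : V) : ℝ := N.p x y * h y / h x

/-- `n`-step transition probabilities of the `h`-process. -/
noncomputable def phstep (h : V → ℝ) : ℕ → V → V → ℝ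
  | 0, x, y => if x = y then 1 else 0
  | n + 1, x, y => ∑' z, phstep h n x z * N.ph h z y

/-- The initial distribution `μ_h(v) = c_{ov} h(v)`. -/
noncomputable def muh (o : V) (h : V → ℝ) (v : V) : ℝ := N.c o v * h v

end Network

/-- `P` is the law of the Markov chain with initial distribution `μ` and transition
probabilities `q`, as a measure on trajectory space. -/
def IsChainLaw {S : Type*} [MeasurableSpace S] (μ : S → ℝ) (q : S → S → ℝ)
    (P : MeasureTheory.Measure (ℕ → S)) : Prop :=
  ∀ (n : ℕ) (v : ℕ → S),
    P {ω | ∀ i ≤ n, ω i = v i} =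
      ENNReal.ofReal (μ (v 0) * ∏ i ∈ Finset.range n, q (v i) (v (i + 1)))

namespace Network

variable {V : Type*} (N : Network V)

/-- The finite set of neighbours. -/
noncomputable def nb (x : V) : Finset V := (N.locFin x).toFinset

lemma mem_nb {x y : V} : y ∈ N.nb x ↔ 0 < N.c x y := by simp [nb]

lemma c_eq_zero {x y : V} (h : y ∉ N.nb x) : N.c x y = 0 := by
  rw [mem_nb] at h
  exact le_antisymm (not_lt.1 h) (N.nonneg x y)

lemma cTot_pos (x : V) : 0 < N.cTot x := N.deg_pos x

lemma cTot_eq (x : V) : N.cTot x = ∑ y ∈ N.nb x, N.c x y :=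
  tsum_eq_sum (fun _ hy => N.c_eq_zero hy)

lemma p_nonneg (x y : V) : 0 ≤ N.p x y := div_nonneg (N.nonneg x y) (N.cTot_pos x).le

lemma p_eq_zero {x y : V} (h : y ∉ N.nb x) : N.p x y = 0 := by
  simp [p, N.c_eq_zero h]

lemma cTot_mul_p (x y : V) : N.cTot x * N.p x y = N.c x y := by
  unfold p; field_simp [(N.cTot_pos x).ne']

lemma p_sum (x : V) : ∑ y ∈ N.nb x, N.p x y = 1 := by
  unfold p
  rw [← Finset.sum_div, ← N.cTot_eq, div_self (N.cTot_pos x).ne']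

/-- Transition operator. -/
noncomputable def P : Module.End ℝ (V → ℝ) where
  toFun f x := ∑ y ∈ N.nb x, N.p x y * f y
  map_add' f g := by
    funext x; simp [mul_add, Finset.sum_add_distrib]
  map_smul' a f := by
    funext x; simp [Finset.mul_sum, mul_left_comm]

/-- Transition operator killed at `o`. -/
noncomputable def Q (o : V) : Module.End ℝ (V → ℝ) where
  toFun f x := if x = o then 0 else N.P f x
  map_add' f g := by
    funext x; by_cases h : x = o <;> simp [h]
  map_smul' a f := by
    funext x; by_cases h : x = o <;> simp [h]

lemma P_apply (f : V → ℝ) (x : V) : N.P f x = ∑ y ∈ N.nb x, N.p x y * f y := rfl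
lemma Q_apply (o : V) (f : V → ℝ) (x : V) : N.Q o f x = if x = o then 0 else N.P f x := rfl
lemma Q_o (o : V) (f : V → ℝ) : N.Q o f o = 0 := by simp [Q_apply]
lemma Q_ne {o x : V} (h : x ≠ o) (f : V → ℝ) : N.Q o f x = N.P f x := by simp [Q_apply, h]

/-- A linear operator that is positive, finite range and pointwise continuous. -/
structure Good (T : Module.End ℝ (V → ℝ)) : Prop where
  pos : ∀ f : V → ℝ, 0 ≤ f → 0 ≤ T f
  fin : ∀ f : V → ℝ, f.support.Finite → (T f).support.Finite
  cont : Continuous T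

lemma good_P : Good N.P where
  pos f hf x := Finset.sum_nonneg fun y _ => mul_nonneg (N.p_nonneg x y) (hf y)
  fin f hf := by
    refine (hf.toFinset.biUnion N.nb).finite_toSet.subset ?_
    intro x hx
    rw [Function.mem_support, P_apply] at hx
    obtain ⟨y, hy, hne⟩ := Finset.exists_ne_zero_of_sum_ne_zero hx
    simp only [Finset.coe_biUnion, Set.mem_iUnion]
    refine ⟨y, by simpa using right_ne_zero_of_mul hne, ?_⟩
    rw [Finset.mem_coe, mem_nb, N.symm, ← mem_nb]; exact hy
  cont := by
    refine continuous_pi fun x => ?_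
    exact continuous_finsetSum _ fun y _ => continuous_const.mul (continuous_apply y)

lemma good_Q (o : V) : Good (N.Q o) where
  pos f hf x := by
    rw [Q_apply]; split_ifs
    · exact le_rfl
    · exact N.good_P.pos f hf x
  fin f hf := by
    refine (N.good_P.fin f hf).subset fun x hx => ?_
    rw [Function.mem_support, Q_apply] at hx
    split_ifs at hx with h
    · exact absurd rfl hx
    · exact hx
  cont := by
    refine continuous_pi fun x => ?_
    by_cases h : x = o
    · simp only [Q_apply, h, if_true]; exact continuous_const
    · simp only [Q_apply, h, if_false]; exact (continuous_apply x).comp N.good_P.cont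

section
variable {T : Module.End ℝ (V → ℝ)}

lemma Good.pow_succ_apply (T : Module.End ℝ (V → ℝ)) (n : ℕ) (f : V → ℝ) :
    (T ^ (n + 1)) f = T ((T ^ n) f) := by
  rw [_root_.pow_succ', Module.End.mul_apply]

lemma Good.pow_succ_apply' (T : Module.End ℝ (V → ℝ)) (n : ℕ) (f : V → ℝ) :
    (T ^ (n + 1)) f = (T ^ n) (T f) := by
  rw [_root_.pow_succ, Module.End.mul_apply]

lemma Good.pow (hT : Good T) (n : ℕ) : Good (T ^ n) := by
  induction n with
  | zero => exact ⟨fun f hf => by simpa using hf, fun f hf => by simpa using hf,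
      by rw [pow_zero]; exact continuous_id⟩
  | succ n ih =>
    refine ⟨fun f hf => ?_, fun f hf => ?_, ?_⟩
    · rw [Good.pow_succ_apply]; exact hT.pos _ (ih.pos f hf)
    · rw [Good.pow_succ_apply]; exact hT.fin _ (ih.fin f hf)
    · have : (⇑(T ^ (n + 1)) : (V → ℝ) → V → ℝ) = T ∘ (T ^ n) := by
        funext f; rw [Good.pow_succ_apply]; rfl
      rw [this]; exact hT.cont.comp ih.cont

lemma Good.mono (hT : Good T) {f g : V → ℝ} (h : f ≤ g) : T f ≤ T g := by
  have := hT.pos (g - f) (sub_nonneg.2 h)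
  rw [map_sub] at this
  exact sub_nonneg.1 this

/-- Partial Green operator. -/
noncomputable def SS (T : Module.End ℝ (V → ℝ)) (n : ℕ) : Module.End ℝ (V → ℝ) :=
  ∑ k ∈ Finset.range n, T ^ k

lemma SS_apply (n : ℕ) (f : V → ℝ) : SS T n f = ∑ k ∈ Finset.range n, (T ^ k) f := by
  simp [SS]

lemma SS_apply_apply (n : ℕ) (f : V → ℝ) (x : V) :
    SS T n f x = ∑ k ∈ Finset.range n, (T ^ k) f x := by
  simp [SS]

lemma Good.SS (hT : Good T) (n : ℕ) : Good (SS T n) where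
  pos f hf := by
    rw [SS_apply]; exact Finset.sum_nonneg fun k _ => (hT.pow k).pos f hf
  fin f hf := by
    rw [SS_apply]
    refine (Set.Finite.biUnion (Finset.finite_toSet (Finset.range n))
      (fun k _ => (hT.pow k).fin f hf)).subset ?_
    intro x hx
    rw [Function.mem_support, Finset.sum_apply] at hx
    obtain ⟨k, hk, hne⟩ := Finset.exists_ne_zero_of_sum_ne_zero hx
    simp only [Set.mem_iUnion]
    exact ⟨k, hk, hne⟩
  cont := by
    have : (⇑(Network.SS T n) : (V → ℝ) → V → ℝ) =
        fun f => ∑ k ∈ Finset.range n, (T ^ k) f := by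
      funext f; rw [SS_apply]
    rw [this]
    exact continuous_finsetSum _ fun k _ => (hT.pow k).cont

lemma SS_sub (n : ℕ) (f : V → ℝ) : SS T n (f - T f) = f - (T ^ n) f := by
  have : SS T n * (1 - T) = 1 - T ^ n := geom_sum_mul_neg T n
  have := congrArg (fun A => A f) this
  simpa using this

lemma sub_SS (n : ℕ) (f : V → ℝ) : SS T n f - T (SS T n f) = f - (T ^ n) f := by
  have : (1 - T) * SS T n = 1 - T ^ n := mul_neg_geom_sum T n
  have := congrArg (fun A => A f) this
  simpa using this

/-- Domination principle. -/
lemma Good.SS_le (hT : Good T) (n : ℕ) {f θ : V → ℝ} (hf : 0 ≤ f) (h : θ ≤ f - T f) :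
    Network.SS T n θ ≤ f := by
  refine ((hT.SS n).mono h).trans ?_
  rw [SS_sub]
  exact sub_le_self _ ((hT.pow n).pos f hf)

end

/-- Dirac function. -/
noncomputable def dl (z : V) : V → ℝ := fun x => if x = z then 1 else 0

lemma dl_nonneg (z : V) : 0 ≤ dl z := fun x => by
  unfold dl; split_ifs <;> simp

lemma dl_fin (z : V) : (dl z).support.Finite := by
  refine (Set.finite_singleton z).subset fun x hx => ?_
  by_contra h
  simp at h
  simp [dl, h] at hx

lemma P_dl (z x : V) : N.P (dl z) x = N.p x z := by
  rw [P_apply]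
  simp only [dl, mul_ite, mul_one, mul_zero]
  rw [Finset.sum_ite_eq']
  split_ifs with h
  · rfl
  · exact (N.p_eq_zero h).symm

lemma pstep_zero_of (n : ℕ) (x : V) : ∃ S : Finset V, ∀ z, z ∉ S → N.pstep n x z = 0 := by
  induction n with
  | zero => exact ⟨{x}, fun z hz => by
      have : x ≠ z := fun h => hz (by simp [h])
      simp [pstep, this]⟩
  | succ n ih =>
    obtain ⟨S, hS⟩ := ih
    refine ⟨S.biUnion N.nb, fun z hz => ?_⟩
    simp only [pstep]
    rw [tsum_eq_sum (s := S) (fun y hy => by rw [hS y hy, zero_mul])]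
    refine Finset.sum_eq_zero fun y hy => ?_
    rw [N.p_eq_zero, mul_zero]
    intro h; exact hz (Finset.mem_biUnion.2 ⟨y, hy, h⟩)

lemma P_eq_sum (f : V → ℝ) (x : V) (S : Finset V) (hS : N.nb x ⊆ S) :
    N.P f x = ∑ y ∈ S, N.p x y * f y := by
  rw [P_apply]
  exact Finset.sum_subset hS fun y _ hy => by rw [N.p_eq_zero hy, zero_mul]

lemma pow_P_apply (n : ℕ) (f : V → ℝ) (x : V) (S : Finset V)
    (hS : ∀ z, z ∉ S → N.pstep n x z = 0) :
    (N.P ^ n) f x = ∑ z ∈ S, N.pstep n x z * f z := by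
  induction n generalizing f S with
  | zero =>
    simp only [pstep, ite_mul, one_mul, zero_mul, pow_zero, Module.End.one_apply]
    rw [Finset.sum_ite_eq]
    split_ifs with h
    · rfl
    · have := hS x h
      simp [pstep] at this
  | succ n ih =>
    obtain ⟨S', hS'⟩ := N.pstep_zero_of n x
    rw [Good.pow_succ_apply', ih (N.P f) S' hS']
    have h1 : ∀ z, N.pstep (n + 1) x z = ∑ y ∈ S', N.pstep n x y * N.p y z := fun z => by
      simp only [pstep]
      exact tsum_eq_sum (s := S') (fun y hy => by rw [hS' y hy, zero_mul])
    have h2 : ∑ z ∈ S, N.pstep (n + 1) x z * f z =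
        ∑ z ∈ S ∪ S'.biUnion N.nb, N.pstep (n + 1) x z * f z :=
      Finset.sum_subset Finset.subset_union_left fun z _ hz => by rw [hS z hz, zero_mul]
    rw [h2]
    simp_rw [h1, Finset.sum_mul]
    rw [Finset.sum_comm]
    refine Finset.sum_congr rfl fun y hy => ?_
    rw [N.P_eq_sum f y (S ∪ S'.biUnion N.nb), Finset.mul_sum]
    · refine Finset.sum_congr rfl fun z _ => by ring
    · exact (Finset.subset_biUnion_of_mem N.nb hy).trans Finset.subset_union_right

lemma pow_P_dl (n : ℕ) (x z : V) : (N.P ^ n) (dl z) x = N.pstep n x z := by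
  obtain ⟨S, hS⟩ := N.pstep_zero_of n x
  rw [N.pow_P_apply n _ x S hS]
  simp only [dl, mul_ite, mul_one, mul_zero]
  rw [Finset.sum_ite_eq']
  split_ifs with h
  · rfl
  · exact (hS z h).symm

lemma SS_P_tendsto (hrec : N.Recurrent) (z : V) :
    Tendsto (fun n => SS N.P n (dl z) z) atTop atTop := by
  simp only [SS_apply_apply, pow_P_dl]
  refine (not_summable_iff_tendsto_nat_atTop_of_nonneg fun n => ?_).1 (hrec z)
  rw [← pow_P_dl]
  exact (N.good_P.pow n).pos _ (dl_nonneg z) z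

lemma super_harm (hrec : N.Recurrent) {s : V → ℝ} (hs : 0 ≤ s) (hP : N.P s ≤ s) :
    N.P s = s := by
  by_contra hne
  obtain ⟨z, hz⟩ : ∃ z, N.P s z < s z := by
    by_contra hcon
    push Not at hcon
    exact hne (le_antisymm hP hcon)
  have hd : (s z - N.P s z) • dl z ≤ s - N.P s := fun x => by
    by_cases h : x = z
    · subst h; simp [dl]
    · simpa [dl, h] using hP x
  have := fun n => N.good_P.SS_le n hs hd z
  simp only [map_smul, Pi.smul_apply, smul_eq_mul] at this
  obtain ⟨n, hn⟩ := ((N.SS_P_tendsto hrec z).eventually_gt_atTop (s z / (s z - N.P s z))).exists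
  rw [div_lt_iff₀ (by linarith)] at hn
  linarith [this n]

lemma P_const (a : ℝ) (x : V) : N.P (fun _ => a) x = a := by
  rw [P_apply, ← Finset.sum_mul, p_sum, one_mul]

lemma liouville (hrec : N.Recurrent) {s : V → ℝ} (hs : 0 ≤ s) (hP : N.P s ≤ s) (x y : V) :
    s x = s y := by
  have key : ∀ a b, 0 < N.c a b → s a ≤ s b := by
    intro a b hab
    have h1 : N.P (fun v => min (s v) (s a)) = fun v => min (s v) (s a) := by
      apply N.super_harm hrec
      · intro v; exact le_min (hs v) (hs a)
      · intro v
        refine le_min ?_ ?_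
        · exact (N.good_P.mono (f := fun v => min (s v) (s a)) (g := s)
            (fun v => min_le_left _ _) v).trans (hP v)
        · refine (N.good_P.mono (f := fun v => min (s v) (s a)) (g := fun _ => s a)
            (fun v => min_le_right _ _) v).trans_eq (N.P_const _ _)
    have h2 := congrFun h1 a
    simp only [min_self] at h2
    by_contra hlt
    push Not at hlt
    have h3 : N.P (fun v => min (s v) (s a)) a < N.P (fun _ => s a) a := by
      rw [P_apply, P_apply]
      refine Finset.sum_lt_sum (fun v _ => mul_le_mul_of_nonneg_left (min_le_right _ _)
        (N.p_nonneg _ _)) ⟨b, N.mem_nb.2 hab, ?_⟩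
      refine mul_lt_mul_of_pos_left (by simpa using hlt) ?_
      exact div_pos hab (N.cTot_pos a)
    rw [h2, P_const] at h3
    exact lt_irrefl _ h3
  induction N.conn x y with
  | refl => rfl
  | tail _ hab ih => exact ih.trans (le_antisymm (key _ _ hab) (key _ _ (by rw [N.symm]; exact hab)))

end Network

namespace Network

variable {V : Type*} (N : Network V)

/-- Inner product weighted by total conductances. -/
noncomputable def ip (f g : V → ℝ) : ℝ := ∑ᶠ x, N.cTot x * f x * g x

lemma ip_comm (f g : V → ℝ) : N.ip f g = N.ip g f := by
  unfold ip; congr 1; funext x; ring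

lemma ip_eq {f : V → ℝ} (g : V → ℝ) {S : Finset V} (hS : f.support ⊆ S) :
    N.ip f g = ∑ x ∈ S, N.cTot x * f x * g x := by
  refine finsum_eq_sum_of_support_subset _ fun x hx => hS ?_
  rw [Function.mem_support] at hx ⊢
  intro h; simp [h] at hx

lemma exS {f : V → ℝ} (hf : f.support.Finite) : ∃ S : Finset V, f.support ⊆ S :=
  ⟨hf.toFinset, by simp⟩

lemma ip_sub_right {f : V → ℝ} (hf : f.support.Finite) (g g' : V → ℝ) :
    N.ip f (g - g') = N.ip f g - N.ip f g' := by
  obtain ⟨S, hS⟩ := exS hf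
  rw [N.ip_eq _ hS, N.ip_eq _ hS, N.ip_eq _ hS, ← Finset.sum_sub_distrib]
  exact Finset.sum_congr rfl fun x _ => by simp; ring

lemma ip_nonneg {f g : V → ℝ} (hf : 0 ≤ f) (hg : 0 ≤ g) : 0 ≤ N.ip f g :=
  finsum_nonneg fun x => mul_nonneg (mul_nonneg (N.cTot_pos x).le (hf x)) (hg x)

lemma ip_dl (z : V) (g : V → ℝ) : N.ip (dl z) g = N.cTot z * g z := by
  rw [N.ip_eq (S := {z}) g]
  · simp [dl]
  · intro x hx
    by_contra h
    simp at h
    simp [dl, h] at hx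

lemma c_sum_le (x : V) (S : Finset V) : ∑ y ∈ S, N.c x y ≤ N.cTot x := by
  rw [cTot_eq]
  calc ∑ y ∈ S, N.c x y ≤ ∑ y ∈ S ∪ N.nb x, N.c x y :=
        Finset.sum_le_sum_of_subset_of_nonneg Finset.subset_union_left fun y _ _ => N.nonneg x y
    _ = _ := (Finset.sum_subset Finset.subset_union_right fun y _ hy => N.c_eq_zero hy).symm

lemma cTot_mul_P {f : V → ℝ} {S : Finset V} (hS : f.support ⊆ S) (x : V) :
    N.cTot x * N.P f x = ∑ y ∈ S, N.c x y * f y := by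
  rw [N.P_eq_sum f x (S ∪ N.nb x) Finset.subset_union_right, Finset.mul_sum]
  rw [Finset.sum_subset (Finset.subset_union_left (s₁ := S) (s₂ := N.nb x))]
  · exact Finset.sum_congr rfl fun y _ => by rw [← mul_assoc, cTot_mul_p]
  · intro y _ hy
    have : f y = 0 := by
      by_contra h
      exact hy (hS h)
    simp [this]

lemma ip_P {f g : V → ℝ} {S : Finset V} (hf : f.support ⊆ S) (hg : g.support ⊆ S) :
    N.ip f (N.P g) = ∑ x ∈ S, ∑ y ∈ S, N.c x y * f x * g y := by
  rw [N.ip_eq _ hf]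
  refine Finset.sum_congr rfl fun x _ => ?_
  rw [mul_right_comm, N.cTot_mul_P hg, Finset.sum_mul]
  exact Finset.sum_congr rfl fun y _ => by ring

lemma ip_P_symm {f g : V → ℝ} (hf : f.support.Finite) (hg : g.support.Finite) :
    N.ip f (N.P g) = N.ip g (N.P f) := by
  have h1 : f.support ⊆ (hf.union hg).toFinset := by simp
  have h2 : g.support ⊆ (hf.union hg).toFinset := by simp
  rw [N.ip_P h1 h2, N.ip_P h2 h1, Finset.sum_comm]
  exact Finset.sum_congr rfl fun x _ => Finset.sum_congr rfl fun y _ => by rw [N.symm]; ring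

lemma energy_nonneg {f : V → ℝ} (hf : f.support.Finite) : 0 ≤ N.ip f (f - N.P f) := by
  rw [N.ip_sub_right hf]
  obtain ⟨S, hS⟩ := exS hf
  rw [N.ip_eq _ hS, N.ip_P hS hS]
  have h1 : ∑ x ∈ S, ∑ y ∈ S, N.c x y * f x * f y ≤
      ∑ x ∈ S, ∑ y ∈ S, (N.c x y * (f x * f x) / 2 + N.c x y * (f y * f y) / 2) := by
    refine Finset.sum_le_sum fun x _ => Finset.sum_le_sum fun y _ => ?_
    nlinarith [mul_nonneg (N.nonneg x y) (sq_nonneg (f x - f y))]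
  have h2 : ∑ x ∈ S, ∑ y ∈ S, (N.c x y * (f x * f x) / 2 + N.c x y * (f y * f y) / 2) =
      ∑ x ∈ S, ∑ y ∈ S, N.c x y * (f x * f x) := by
    simp_rw [Finset.sum_add_distrib]
    have : ∑ x ∈ S, ∑ y ∈ S, N.c x y * (f y * f y) / 2 =
        ∑ x ∈ S, ∑ y ∈ S, N.c x y * (f x * f x) / 2 := by
      rw [Finset.sum_comm]
      exact Finset.sum_congr rfl fun x _ => Finset.sum_congr rfl fun y _ => by rw [N.symm]
    rw [this, ← Finset.sum_add_distrib]
    refine Finset.sum_congr rfl fun x _ => ?_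
    rw [← Finset.sum_add_distrib]
    exact Finset.sum_congr rfl fun y _ => by ring
  have h3 : ∑ x ∈ S, ∑ y ∈ S, N.c x y * (f x * f x) ≤ ∑ x ∈ S, N.cTot x * f x * f x := by
    refine Finset.sum_le_sum fun x _ => ?_
    rw [← Finset.sum_mul, mul_assoc]
    exact mul_le_mul_of_nonneg_right (N.c_sum_le x S) (mul_self_nonneg _)
  linarith

lemma energy_SS {T : Module.End ℝ (V → ℝ)} (hT : Good T) (n : ℕ) {θ : V → ℝ} (h0 : 0 ≤ θ)
    (hθ : θ.support.Finite) :
    N.ip (SS T n θ) (SS T n θ - T (SS T n θ)) ≤ N.ip θ (SS T n θ) := by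
  rw [sub_SS, N.ip_sub_right ((hT.SS n).fin _ hθ), N.ip_comm θ]
  linarith [N.ip_nonneg ((hT.SS n).pos _ h0) ((hT.pow n).pos _ h0)]

variable (o : V)

lemma pow_Q_o (n : ℕ) {f : V → ℝ} (hf : f o = 0) : (N.Q o ^ n) f o = 0 := by
  cases n with
  | zero => simpa using hf
  | succ n => rw [Good.pow_succ_apply, Q_o]

lemma SS_Q_o (n : ℕ) {f : V → ℝ} (hf : f o = 0) : SS (N.Q o) n f o = 0 := by
  rw [SS_apply_apply]
  exact Finset.sum_eq_zero fun k _ => N.pow_Q_o o k hf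

lemma ip_Q {f : V → ℝ} (hf : f o = 0) (g : V → ℝ) : N.ip f (N.Q o g) = N.ip f (N.P g) := by
  unfold ip
  congr 1; funext x
  by_cases h : x = o
  · simp [h, hf]
  · rw [N.Q_ne h]

lemma pow_Q_symm (n : ℕ) {f g : V → ℝ} (hf : f.support.Finite) (hg : g.support.Finite)
    (hfo : f o = 0) (hgo : g o = 0) :
    N.ip f ((N.Q o ^ n) g) = N.ip g ((N.Q o ^ n) f) := by
  induction n generalizing f g with
  | zero => simpa using N.ip_comm f g
  | succ n ih =>
    rw [Good.pow_succ_apply', ih hf ((N.good_Q o).fin g hg) hfo (N.Q_o o g), Good.pow_succ_apply,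
      N.ip_Q o hgo, N.ip_P_symm hg (((N.good_Q o).pow n).fin f hf),
      ← N.ip_Q o (N.pow_Q_o o n hfo), N.ip_comm]

lemma pow_Q_dl_symm (n : ℕ) {x z : V} (hx : x ≠ o) (hz : z ≠ o) :
    N.cTot x * (N.Q o ^ n) (dl z) x = N.cTot z * (N.Q o ^ n) (dl x) z := by
  rw [← ip_dl, ← ip_dl]
  exact N.pow_Q_symm o n (dl_fin x) (dl_fin z) (by simp [dl, hx.symm]) (by simp [dl, hz.symm])

/-- Indicator of the complement of the root. -/
noncomputable def ee : V → ℝ := fun x => if x = o then 0 else 1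

lemma ee_nonneg : 0 ≤ ee o := fun x => by unfold ee; split_ifs <;> simp

lemma P_ee (x : V) : N.P (ee o) x = 1 - N.p x o := by
  have : ee o = (fun _ => (1 : ℝ)) - dl o := by
    funext x; by_cases h : x = o <;> simp [ee, dl, h]
  rw [this, map_sub, Pi.sub_apply, P_const, P_dl]

lemma ee_sub (x : V) : (ee o - N.Q o (ee o)) x = if x = o then 0 else N.p x o := by
  by_cases h : x = o
  · simp [h, ee, Q_o]
  · rw [Pi.sub_apply, N.Q_ne h, P_ee]; simp [ee, h]

lemma ee_sub_eq : ee o - N.Q o (ee o) = ∑ y ∈ (N.nb o).erase o, N.p y o • dl y := by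
  funext x
  rw [ee_sub, Finset.sum_apply]
  simp only [Pi.smul_apply, dl, smul_eq_mul, mul_ite, mul_one, mul_zero]
  rw [Finset.sum_ite_eq]
  by_cases h : x = o
  · simp [h]
  · simp only [h, if_false, Finset.mem_erase, ne_eq, not_false_eq_true, true_and]
    split_ifs with h'
    · rfl
    · rw [mem_nb, N.symm, ← mem_nb] at h'
      exact N.p_eq_zero h'

lemma SS_bound (z : V) (hz : z ≠ o) : ∃ C, ∀ n x, SS (N.Q o) n (dl z) x ≤ C := by
  have hc := N.conn z o
  revert hz
  induction hc using Relation.ReflTransGen.head_induction_on with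
  | refl => exact fun h => absurd rfl h
  | @head z y hzy _ ih =>
    intro hz
    have hp : 0 < N.p z y := div_pos hzy (N.cTot_pos z)
    by_cases hy : y = o
    · subst hy
      refine ⟨1 / N.p z y, fun n x => ?_⟩
      have hd : N.p z y • dl z ≤ ee y - N.Q y (ee y) := fun x => by
        rw [ee_sub]
        by_cases hx : x = z
        · subst hx; simp [dl, hz]
        · simp only [Pi.smul_apply, dl, hx, if_false, smul_zero]
          split_ifs
          · exact le_rfl
          · exact N.p_nonneg _ _
      have := (N.good_Q y).SS_le n (ee_nonneg y) hd x
      rw [map_smul, Pi.smul_apply, smul_eq_mul] at this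
      rw [le_div_iff₀ hp, mul_comm]
      refine this.trans ?_
      unfold ee; split_ifs <;> norm_num
    · obtain ⟨C, hC⟩ := ih hy
      refine ⟨C / N.p z y, fun n x => ?_⟩
      have hd : N.p z y • dl z ≤ N.Q o (dl y) := fun x => by
        by_cases hx : x = z
        · subst hx; rw [N.Q_ne hz, P_dl]; simp [dl]
        · simpa [dl, hx] using (N.good_Q o).pos _ (dl_nonneg y) x
      have h1 := ((N.good_Q o).SS n).mono hd x
      rw [map_smul, Pi.smul_apply, smul_eq_mul] at h1
      rw [le_div_iff₀ hp, mul_comm]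
      refine h1.trans (le_trans ?_ (hC (n + 1) x))
      rw [SS_apply_apply, SS_apply_apply, Finset.sum_range_succ']
      simp only [Good.pow_succ_apply', pow_zero, Module.End.one_apply]
      exact le_add_of_nonneg_right (dl_nonneg y x)

/-- Green function. -/
noncomputable def GG (z x : V) : ℝ := ∑' n, (N.Q o ^ n) (dl z) x

lemma GG_hasSum {z : V} (hz : z ≠ o) (x : V) :
    HasSum (fun n => (N.Q o ^ n) (dl z) x) (N.GG o z x) := by
  obtain ⟨C, hC⟩ := N.SS_bound o z hz
  refine (summable_of_sum_range_le (c := C) (fun n => ((N.good_Q o).pow n).pos _ (dl_nonneg z) x)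
    fun n => ?_).hasSum
  rw [← SS_apply_apply]; exact hC n x

lemma GG_tendsto {z : V} (hz : z ≠ o) (x : V) :
    Tendsto (fun n => SS (N.Q o) n (dl z) x) atTop (𝓝 (N.GG o z x)) := by
  simp only [SS_apply_apply]
  exact (N.GG_hasSum o hz x).tendsto_sum_nat

lemma GG_nonneg (z x : V) : 0 ≤ N.GG o z x :=
  tsum_nonneg fun n => ((N.good_Q o).pow n).pos _ (dl_nonneg z) x

lemma GG_bound {z : V} (hz : z ≠ o) : ∃ C, ∀ x, N.GG o z x ≤ C := by
  obtain ⟨C, hC⟩ := N.SS_bound o z hz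
  exact ⟨C, fun x => le_of_tendsto' (N.GG_tendsto o hz x) fun n => hC n x⟩

lemma GG_o {z : V} (hz : z ≠ o) : N.GG o z o = 0 := by
  refine tendsto_nhds_unique (N.GG_tendsto o hz o) ?_
  have : (fun n => SS (N.Q o) n (dl z) o) = fun _ => 0 := by
    funext n; exact N.SS_Q_o o n (by simp [dl, hz.symm])
  rw [this]; exact tendsto_const_nhds

lemma GG_symm {x z : V} (hx : x ≠ o) (hz : z ≠ o) :
    N.GG o z x / N.cTot z = N.GG o x z / N.cTot x := by
  rw [div_eq_div_iff (N.cTot_pos z).ne' (N.cTot_pos x).ne']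
  unfold GG
  rw [← tsum_mul_right, ← tsum_mul_right]
  congr 1; funext n
  rw [mul_comm, N.pow_Q_dl_symm o n hx hz, mul_comm]

lemma GG_eq {z : V} (hz : z ≠ o) (x : V) :
    N.GG o z x - N.Q o (N.GG o z) x = dl z x := by
  have h1 : Tendsto (fun n => SS (N.Q o) n (dl z)) atTop (𝓝 (N.GG o z)) :=
    tendsto_pi_nhds.2 fun x => N.GG_tendsto o hz x
  have h2 : Tendsto (fun n => N.Q o (SS (N.Q o) n (dl z))) atTop (𝓝 (N.Q o (N.GG o z))) :=
    ((N.good_Q o).cont.tendsto _).comp h1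
  have h3 := tendsto_pi_nhds.1 (h1.sub h2) x
  have h4 : Tendsto (fun n => (dl z - (N.Q o ^ n) (dl z)) x) atTop (𝓝 (dl z x - 0)) :=
    tendsto_const_nhds.sub (N.GG_hasSum o hz x).summable.tendsto_atTop_zero
  simp only [sub_SS] at h3
  simpa using tendsto_nhds_unique h3 h4

lemma pow_ee_tendsto (hrec : N.Recurrent) (x : V) :
    Tendsto (fun n => (N.Q o ^ n) (ee o) x) atTop (𝓝 0) := by
  have hle : N.Q o (ee o) ≤ ee o := fun x => by
    have := N.ee_sub o x
    rw [Pi.sub_apply] at this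
    have h2 : (0 : ℝ) ≤ if x = o then 0 else N.p x o := by
      split_ifs
      · exact le_rfl
      · exact N.p_nonneg _ _
    linarith
  have hanti : ∀ x, Antitone fun n => (N.Q o ^ n) (ee o) x := fun x =>
    antitone_nat_of_succ_le fun n => by
      rw [Good.pow_succ_apply']
      exact ((N.good_Q o).pow n).mono hle x
  have hnn : ∀ n x, 0 ≤ (N.Q o ^ n) (ee o) x := fun n x =>
    ((N.good_Q o).pow n).pos _ (ee_nonneg o) x
  have hlim : ∀ x, ∃ r, Tendsto (fun n => (N.Q o ^ n) (ee o) x) atTop (𝓝 r) := fun x =>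
    ⟨_, tendsto_atTop_ciInf (hanti x) ⟨0, by rintro _ ⟨n, rfl⟩; exact hnn n x⟩⟩
  choose r hr using hlim
  have hr' : Tendsto (fun n => (N.Q o ^ n) (ee o)) atTop (𝓝 r) := tendsto_pi_nhds.2 hr
  have hQr : N.Q o r = r := by
    have h1 := ((N.good_Q o).cont.tendsto r).comp hr'
    have h2 := hr'.comp (tendsto_add_atTop_nat 1)
    refine tendsto_nhds_unique h1 (h2.congr fun n => ?_)
    simp only [Function.comp, Good.pow_succ_apply]
  have hr0 : 0 ≤ r := fun x => ge_of_tendsto' (hr x) fun n => hnn n x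
  have hr1 : ∀ x, r x ≤ 1 := fun x => by
    refine le_of_tendsto' (hr x) fun n => (hanti x (Nat.zero_le n)).trans ?_
    simp only [pow_zero, Module.End.one_apply, ee]; split_ifs <;> norm_num
  have hro : r o = 0 := by rw [← hQr, Q_o]
  have hP : N.P ((fun _ => (1 : ℝ)) - r) ≤ (fun _ => (1 : ℝ)) - r := fun x => by
    rw [map_sub, Pi.sub_apply, Pi.sub_apply, P_const]
    by_cases hx : x = o
    · subst hx
      have := N.good_P.pos r hr0 x
      simp only [Pi.zero_apply] at this
      linarith
    · rw [← N.Q_ne hx, hQr]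
  have := N.liouville hrec (s := (fun _ => (1 : ℝ)) - r) (fun x => sub_nonneg.2 (hr1 x)) hP x o
  simp only [Pi.sub_apply, hro] at this
  have h0 : r x = 0 := by linarith
  rw [← h0]; exact hr x

/-- Sum of the Green densities around the root. -/
lemma GG_flux (hrec : N.Recurrent) {v : V} (hv : v ≠ o) :
    ∑ y ∈ N.nb o, N.c o y * (N.GG o v y / N.cTot v) = 1 := by
  have h1 : Tendsto (fun n => SS (N.Q o) n (ee o - N.Q o (ee o)) v) atTop (𝓝 1) := by
    simp only [SS_sub, Pi.sub_apply]
    simpa [ee, hv] using (N.pow_ee_tendsto o hrec v).const_sub (ee o v)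
  have h2 : Tendsto (fun n => SS (N.Q o) n (ee o - N.Q o (ee o)) v) atTop
      (𝓝 (∑ y ∈ (N.nb o).erase o, N.p y o * N.GG o y v)) := by
    rw [ee_sub_eq]
    simp only [map_sum, map_smul, Finset.sum_apply, Pi.smul_apply, smul_eq_mul]
    exact tendsto_finsetSum _ fun y hy =>
      (N.GG_tendsto o (Finset.ne_of_mem_erase hy) v).const_mul _
  rw [← tendsto_nhds_unique h2 h1]
  rw [← Finset.sum_erase (N.nb o) (a := o) (by rw [N.GG_o o hv]; simp)]
  refine Finset.sum_congr rfl fun y hy => ?_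
  rw [N.GG_symm o (Finset.ne_of_mem_erase hy) hv, N.symm, p]
  ring

end Network

namespace Network

variable {V : Type*} (N : Network V)

lemma lap_eq (f : V → ℝ) (v : V) : N.lap f v = N.cTot v * (N.P f v - f v) := by
  unfold lap
  rw [tsum_eq_sum (s := N.nb v) (fun y hy => by rw [N.c_eq_zero hy, zero_mul])]
  simp_rw [mul_sub]
  rw [Finset.sum_sub_distrib, ← Finset.sum_mul, ← N.cTot_eq, P_apply, Finset.mul_sum]
  congr 1
  exact Finset.sum_congr rfl fun y _ => by rw [← mul_assoc, cTot_mul_p]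

lemma ip_add_left {f f' : V → ℝ} (hf : f.support.Finite) (hf' : f'.support.Finite) (t : ℝ)
    (g : V → ℝ) : N.ip (f + t • f') g = N.ip f g + t * N.ip f' g := by
  have h1 : f.support ⊆ (hf.union hf').toFinset := by simp
  have h2 : f'.support ⊆ (hf.union hf').toFinset := by simp
  have h3 : (f + t • f').support ⊆ (hf.union hf').toFinset := by
    intro x hx
    by_contra h
    simp only [Set.Finite.coe_toFinset, Set.mem_union, Function.mem_support, not_or,
      not_not] at h
    simp [h.1, h.2] at hx
  rw [N.ip_eq _ h1, N.ip_eq _ h2, N.ip_eq _ h3, Finset.mul_sum, ← Finset.sum_add_distrib]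
  exact Finset.sum_congr rfl fun x _ => by simp; ring

lemma ip_add_right {f : V → ℝ} (hf : f.support.Finite) (t : ℝ) (g g' : V → ℝ) :
    N.ip f (g + t • g') = N.ip f g + t * N.ip f g' := by
  obtain ⟨S, hS⟩ := exS hf
  rw [N.ip_eq _ hS, N.ip_eq _ hS, N.ip_eq _ hS, Finset.mul_sum, ← Finset.sum_add_distrib]
  exact Finset.sum_congr rfl fun x _ => by simp; ring

lemma energy_expand {g φ : V → ℝ} (hg : g.support.Finite) (hφ : φ.support.Finite) (t : ℝ) :
    0 ≤ N.ip g (g - N.P g) + 2 * t * N.ip φ (g - N.P g) + t ^ 2 * N.ip φ (φ - N.P φ) := by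
  have hfin : (g + t • φ).support.Finite := by
    refine (hg.union hφ).subset fun x hx => ?_
    by_contra h
    simp only [Set.mem_union, Function.mem_support, not_or, not_not] at h
    simp [h.1, h.2] at hx
  have h := N.energy_nonneg hfin
  have e : (g + t • φ) - N.P (g + t • φ) = (g - N.P g) + t • (φ - N.P φ) := by
    rw [map_add, map_smul, smul_sub]; abel
  have s : N.ip g (φ - N.P φ) = N.ip φ (g - N.P g) := by
    rw [N.ip_sub_right hg, N.ip_sub_right hφ, N.ip_P_symm hg hφ, N.ip_comm g φ]
  rw [e, N.ip_add_left hg hφ, N.ip_add_right hg, N.ip_add_right hφ, s] at h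
  linarith

variable (o : V)

/-- Green density, as a function of the second variable extended by zero. -/
noncomputable def K (v z : V) : ℝ := if z = o then 0 else N.GG o z v / N.cTot z

lemma K_eq {v : V} (hv : v ≠ o) : N.K o v = (N.cTot v)⁻¹ • N.GG o v := by
  funext z
  unfold K
  split_ifs with hz
  · subst hz; simp [N.GG_o z hv]
  · rw [N.GG_symm o hv hz, Pi.smul_apply, smul_eq_mul, div_eq_inv_mul]

lemma lap_K_o (hrec : N.Recurrent) {v : V} (hv : v ≠ o) : N.lap (N.K o v) o = 1 := by
  rw [← N.GG_flux o hrec hv, lap_eq, N.K_eq o hv, P_apply, Pi.smul_apply, N.GG_o o hv, smul_zero,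
    sub_zero, Finset.mul_sum]
  refine Finset.sum_congr rfl fun y _ => ?_
  rw [← mul_assoc, cTot_mul_p, Pi.smul_apply, smul_eq_mul, div_eq_inv_mul]

lemma lap_K {v z : V} (hv : v ≠ o) (hz : z ≠ o) (hvz : z ≠ v) : N.lap (N.K o v) z = 0 := by
  have := N.GG_eq o hv z
  rw [N.Q_ne hz] at this
  simp only [dl, hvz, if_false] at this
  rw [lap_eq, N.K_eq o hv, map_smul, Pi.smul_apply, Pi.smul_apply, ← smul_sub,
    ← neg_sub (N.GG o v z), this]
  simp

lemma K_tendsto (hrec : N.Recurrent) {h : V → ℝ}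
    (huniq : ∀ h', N.IsPotential o h' → h' = h) (U : Ultrafilter V)
    (hU : (U : Filter V) ≤ cofinite) : Tendsto (N.K o) U (𝓝 h) := by
  have hlim : ∀ z, ∃ a, 0 ≤ a ∧ Tendsto (fun v => N.K o v z) U (𝓝 a) := by
    intro z
    by_cases hz : z = o
    · exact ⟨0, le_rfl, by simp only [K, hz, if_true]; exact tendsto_const_nhds⟩
    · obtain ⟨C, hC⟩ := N.GG_bound o hz
      have hm : ∀ v, N.K o v z ∈ Set.Icc 0 (C / N.cTot z) := fun v => by
        simp only [K, hz, if_false]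
        exact ⟨div_nonneg (N.GG_nonneg o z v) (N.cTot_pos z).le,
          div_le_div_of_nonneg_right (hC v) (N.cTot_pos z).le⟩
      obtain ⟨a, ha, hle⟩ := (isCompact_Icc (a := (0 : ℝ)) (b := C / N.cTot z)).ultrafilter_le_nhds
        (U.map fun v => N.K o v z) (by
          rw [le_principal_iff]
          exact Filter.mem_map.2 (Filter.univ_mem' hm))
      exact ⟨a, ha.1, hle⟩
  choose h' h0 hh using hlim
  have hT : Tendsto (N.K o) U (𝓝 h') := tendsto_pi_nhds.2 hh
  have hne : ∀ z, ∀ᶠ v in (U : Filter V), v ≠ z := fun z =>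
    hU (by simp [Filter.mem_cofinite])
  have hlap : ∀ z, Tendsto (fun v => N.lap (N.K o v) z) U (𝓝 (N.lap h' z)) := fun z => by
    simp only [lap_eq]
    exact ((tendsto_pi_nhds.1 ((N.good_P.cont.tendsto h').comp hT) z).sub (hh z)).const_mul _
  have hp : N.IsPotential o h' := by
    refine ⟨h0, ?_, ?_, fun z hz => ?_⟩
    · refine tendsto_nhds_unique (hh o) ?_
      simp only [K, if_true]; exact tendsto_const_nhds
    · refine tendsto_nhds_unique (hlap o) (tendsto_const_nhds.congr' ?_)
      filter_upwards [hne o] with v hv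
      exact (N.lap_K_o o hrec hv).symm
    · refine tendsto_nhds_unique (hlap z) (tendsto_const_nhds.congr' ?_)
      filter_upwards [hne o, hne z] with v hv hvz
      exact (N.lap_K o hv hz hvz.symm).symm
  rw [← huniq h' hp]; exact hT

/-- Restriction of a function to a finite set. -/
noncomputable def res (F : Finset V) (f : V → ℝ) : V → ℝ := fun x => if x ∈ F then f x else 0

lemma res_fin (F : Finset V) (f : V → ℝ) : (res F f).support ⊆ F := by
  intro x hx
  by_contra h
  rw [Finset.mem_coe] at h
  simp [res, h] at hx

lemma res_tendsto (f : V → ℝ) : Tendsto (fun F => res F f) atTop (𝓝 f) := by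
  refine tendsto_pi_nhds.2 fun x => tendsto_const_nhds.congr' ?_
  filter_upwards [eventually_ge_atTop {x}] with F hF
  simp [res, Finset.singleton_subset_iff.1 hF]

lemma ip_bound {h : V → ℝ} {b : ℝ} {U : Ultrafilter V} (hK : Tendsto (N.K o) U (𝓝 h))
    (hb : ∀ᶠ v in (U : Filter V), h v ≤ b) {f : V → ℝ} (hf : 0 ≤ f) (hfh : f ≤ h)
    (hQ : N.Q o f ≤ f) (hfo : f o = 0) (F : Finset V) :
    N.ip (res F (f - N.Q o f)) h ≤ b := by
  set θ := res F (f - N.Q o f) with hθ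
  have hθo : θ o = 0 := by simp [hθ, res, hfo, Q_o]
  have hθle : θ ≤ f - N.Q o f := fun x => by
    rw [hθ]; unfold res
    split_ifs
    · exact le_rfl
    · exact sub_nonneg.2 (hQ x)
  have hθsum : θ = ∑ z ∈ F, θ z • dl z := by
    funext x
    rw [Finset.sum_apply]
    simp only [Pi.smul_apply, dl, smul_eq_mul, mul_ite, mul_one, mul_zero]
    rw [Finset.sum_ite_eq]
    split_ifs with hx
    · rfl
    · simp [hθ, res, hx]
  have key : ∀ v, N.ip θ (N.K o v) ≤ f v := by
    intro v
    rw [N.ip_eq _ (res_fin F _)]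
    have hl : Tendsto (fun n => ∑ z ∈ F, θ z * SS (N.Q o) n (dl z) v) atTop
        (𝓝 (∑ x ∈ F, N.cTot x * θ x * N.K o v x)) := by
      refine tendsto_finsetSum _ fun z _ => ?_
      by_cases hz : z = o
      · subst hz; simp [hθo]
      · have : N.cTot z * θ z * N.K o v z = θ z * N.GG o z v := by
          simp only [K, hz, if_false]
          field_simp [(N.cTot_pos z).ne']
        rw [this]
        exact (N.GG_tendsto o hz v).const_mul _
    refine le_of_tendsto' hl fun n => ?_
    have := (N.good_Q o).SS_le n hf hθle v
    rw [hθsum] at this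
    simpa [map_sum, Finset.sum_apply] using this
  have hl : Tendsto (fun v => N.ip θ (N.K o v)) U (𝓝 (N.ip θ h)) := by
    simp only [N.ip_eq _ (res_fin F (f - N.Q o f)), hθ]
    exact tendsto_finsetSum _ fun z _ => (tendsto_pi_nhds.1 hK z).const_mul _
  refine le_of_tendsto hl ?_
  filter_upwards [hb] with v hv
  exact ((key v).trans (hfh v)).trans hv

end Network

namespace Network

variable {V : Type*} (N : Network V)

lemma main_bound (hrec : N.Recurrent) (o : V) {h : V → ℝ} (hpot : N.IsPotential o h) {b : ℝ}
    {U : Ultrafilter V} (hK : Tendsto (N.K o) U (𝓝 h))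
    (hb : ∀ᶠ v in (U : Filter V), h v ≤ b) {φ : V → ℝ} (hφ : φ.support.Finite) (t : ℝ) :
    0 ≤ b + 2 * t * N.ip φ (h - N.P h) + t ^ 2 * N.ip φ (φ - N.P φ) := by
  obtain ⟨h0, ho, -, hharm⟩ := hpot
  set C : Set (V → ℝ) :=
    {g | 0 ≤ b + 2 * t * N.ip φ (g - N.P g) + t ^ 2 * N.ip φ (φ - N.P φ)} with hC
  have hclosed : IsClosed C := by
    refine isClosed_le continuous_const ?_
    refine (continuous_const.add (continuous_const.mul ?_)).add continuous_const
    obtain ⟨S, hS⟩ := exS hφ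
    simp only [N.ip_eq _ hS]
    refine continuous_finsetSum _ fun x _ => continuous_const.mul ?_
    exact (continuous_apply x).comp (continuous_id.sub N.good_P.cont)
  have hQh : N.Q o h = h := by
    funext x
    by_cases hx : x = o
    · subst hx; rw [Q_o, ho]
    · rw [N.Q_ne hx]
      have := hharm x hx
      rw [lap_eq] at this
      have := (mul_eq_zero.1 this).resolve_left (N.cTot_pos x).ne'
      linarith
  -- the truncations
  have hmem : ∀ k : ℕ, (fun x => min (h x) (k : ℝ)) ∈ C := by
    intro k
    set f : V → ℝ := fun x => min (h x) (k : ℝ) with hf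
    have hf0 : 0 ≤ f := fun x => le_min (h0 x) (Nat.cast_nonneg k)
    have hfh : f ≤ h := fun x => min_le_left _ _
    have hfo : f o = 0 := by simp [hf, ho]
    have hfk : f ≤ (k : ℝ) • ee o := fun x => by
      by_cases hx : x = o
      · subst hx; simp [hfo, ee]
      · simp [ee, hx, hf]
    have hQf : N.Q o f ≤ f := fun x => by
      refine le_min ?_ ?_
      · have := (N.good_Q o).mono hfh x
        rwa [hQh] at this
      · rw [Q_apply]
        split_ifs
        · exact Nat.cast_nonneg k
        · exact (N.good_P.mono (f := f) (g := fun _ => (k : ℝ))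
            (fun v => min_le_right _ _) x).trans_eq (N.P_const _ _)
    have hmem1 : ∀ (n : ℕ) (F : Finset V), SS (N.Q o) n (res F (f - N.Q o f)) ∈ C := by
      intro n F
      set θ := res F (f - N.Q o f) with hθ
      have hθo : θ o = 0 := by simp [hθ, res, hfo, Q_o]
      have hθ0 : 0 ≤ θ := fun x => by
        rw [hθ]; unfold res
        split_ifs
        · exact sub_nonneg.2 (hQf x)
        · exact le_rfl
      have hθle : θ ≤ f - N.Q o f := fun x => by
        rw [hθ]; unfold res
        split_ifs
        · exact le_rfl
        · exact sub_nonneg.2 (hQf x)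
      have hθfin : θ.support.Finite := F.finite_toSet.subset (res_fin F _)
      set g := SS (N.Q o) n θ with hg
      have hgfin : g.support.Finite := ((N.good_Q o).SS n).fin _ hθfin
      have hgo : g o = 0 := N.SS_Q_o o n hθo
      have hgh : g ≤ h := ((N.good_Q o).SS_le n hf0 hθle).trans hfh
      have e1 : N.ip g (g - N.P g) ≤ b := by
        have h1 := N.energy_SS (N.good_Q o) n hθ0 hθfin
        rw [← hg, N.ip_sub_right hgfin, N.ip_Q o hgo, ← N.ip_sub_right hgfin] at h1
        have h2 : N.ip θ g ≤ N.ip θ h := by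
          have := N.ip_nonneg hθ0 (sub_nonneg.2 hgh)
          rw [N.ip_sub_right hθfin] at this
          linarith
        exact (h1.trans h2).trans (N.ip_bound o hK hb hf0 hfh hQf hfo F)
      have e2 := N.energy_expand hgfin hφ t
      simp only [hC, Set.mem_setOf_eq]
      linarith
    have hmem2 : ∀ n : ℕ, f - (N.Q o ^ n) f ∈ C := by
      intro n
      rw [← SS_sub]
      exact hclosed.mem_of_tendsto ((((N.good_Q o).SS n).cont.tendsto _).comp (res_tendsto _))
        (Eventually.of_forall fun F => hmem1 n F)
    refine hclosed.mem_of_tendsto (f := fun n : ℕ => f - (N.Q o ^ n) f) (b := atTop) ?_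
      (Eventually.of_forall hmem2)
    refine tendsto_pi_nhds.2 fun x => ?_
    have hz : Tendsto (fun n => (N.Q o ^ n) f x) atTop (𝓝 0) := by
      refine squeeze_zero (fun n => ((N.good_Q o).pow n).pos f hf0 x)
        (fun n => ((N.good_Q o).pow n).mono hfk x) ?_
      simpa using (N.pow_ee_tendsto o hrec x).const_mul (k : ℝ)
    simpa using hz.const_sub (f x)
  have : h ∈ C := by
    refine hclosed.mem_of_tendsto (f := fun (k : ℕ) x => min (h x) (k : ℝ)) (b := atTop) ?_
      (Eventually.of_forall hmem)
    refine tendsto_pi_nhds.2 fun x => tendsto_const_nhds.congr' ?_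
    filter_upwards [(tendsto_natCast_atTop_atTop (R := ℝ)).eventually_ge_atTop (h x)] with k hk
    exact (min_eq_left hk).symm
  exact this

lemma ip_potential (o : V) {h : V → ℝ} (hpot : N.IsPotential o h) {φ : V → ℝ} :
    N.ip φ (h - N.P h) = - φ o := by
  obtain ⟨-, -, h1, hharm⟩ := hpot
  have : ∀ x, N.cTot x * φ x * (h - N.P h) x = if x = o then - φ x else 0 := fun x => by
    rw [Pi.sub_apply]
    split_ifs with hx
    · subst hx
      rw [lap_eq] at h1
      linear_combination (-φ x) * h1
    · have := hharm x hx
      rw [lap_eq] at this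
      linear_combination (-φ x) * this
  unfold ip
  rw [finsum_congr this, finsum_eq_single _ o (fun x hx => by simp [hx])]
  simp

end Network

/-- If a recurrent rooted network has a unique potential `h`, then `h`
tends to infinity: every level set `{h ≤ b}` is finite. -/
theorem unique_potential_tends_to_infinity {V : Type*} (N : Network V) (hrec : N.Recurrent)
    (o : V) (h : V → ℝ) (hpot : N.IsPotential o h)
    (huniq : ∀ h', N.IsPotential o h' → h' = h) :
    ∀ b : ℝ, 0 < b → {v : V | h v ≤ b}.Finite := by
  intro b hb
  by_contra hinf
  have hne : (cofinite ⊓ 𝓟 {v : V | h v ≤ b}).NeBot :=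
    Filter.cofinite_inf_principal_neBot_iff.2 hinf
  set U : Ultrafilter V := Ultrafilter.of (cofinite ⊓ 𝓟 {v : V | h v ≤ b}) with hUdef
  have hU : (U : Filter V) ≤ cofinite ⊓ 𝓟 {v : V | h v ≤ b} := Ultrafilter.of_le _
  have hK := N.K_tendsto o hrec huniq U (hU.trans inf_le_left)
  have hbU : ∀ᶠ v in (U : Filter V), h v ≤ b :=
    (hU.trans inf_le_right) (Filter.mem_principal_self _)
  have hc := N.cTot_pos o
  have key : ∀ n, Network.SS N.P n (Network.dl o) o ≤ b * N.cTot o := by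
    intro n
    have hfin := (N.good_P.SS n).fin _ (Network.dl_fin o)
    have h1 := N.main_bound hrec o hpot hK hbU hfin (1 / N.cTot o)
    have h2 := N.energy_SS N.good_P n (Network.dl_nonneg o) (Network.dl_fin o)
    rw [N.ip_dl] at h2
    rw [N.ip_potential o hpot] at h1
    have h3 := mul_le_mul_of_nonneg_left h2 (sq_nonneg (1 / N.cTot o))
    have h4 : (1 / N.cTot o) ^ 2 * (N.cTot o * Network.SS N.P n (Network.dl o) o) =
        Network.SS N.P n (Network.dl o) o / N.cTot o := by
      field_simp
    have h5 : 2 * (1 / N.cTot o) * -Network.SS N.P n (Network.dl o) o =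
        -2 * (Network.SS N.P n (Network.dl o) o / N.cTot o) := by
      ring
    rw [h4] at h3
    rw [h5] at h1
    rw [← div_le_iff₀ hc]
    linarith
  obtain ⟨n, hn⟩ := ((N.SS_P_tendsto hrec o).eventually_gt_atTop (b * N.cTot o)).exists
  exact absurd (key n) (not_le.2 hn)
end

section
/- On every recurrent rooted network (G,c,o), there exists a potential h that tends to infinity, i.e., h≥0, h(o)=0, Δh=1_o, h harmonic off o, and {v : h(v)≤M} is finite for every M>0. -/
open scoped Classical
open Filter Topology MeasureTheory ProbabilityTheory

namespace Network

section Aux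

variable {V : Type*} (N : Network V)

lemma lap_eq_s15 (f : V → ℝ) (x : V) :
    N.lap f x = ∑ y ∈ N.nb x, N.c x y * (f y - f x) := by
  unfold lap
  refine tsum_eq_sum fun y hy => ?_
  rw [N.c_eq_zero hy, zero_mul]

lemma lap_add (f g : V → ℝ) (x : V) : N.lap (f + g) x = N.lap f x + N.lap g x := by
  simp only [lap_eq_s15, ← Finset.sum_add_distrib, Pi.add_apply]
  exact Finset.sum_congr rfl fun _ _ => by ring

lemma lap_smul (a : ℝ) (f : V → ℝ) (x : V) : N.lap (a • f) x = a * N.lap f x := by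
  simp only [lap_eq_s15, Finset.mul_sum, Pi.smul_apply, smul_eq_mul]
  exact Finset.sum_congr rfl fun _ _ => by ring

lemma lap_shift (f : V → ℝ) (a : ℝ) (x : V) : N.lap (fun y => f y + a) x = N.lap f x := by
  simp only [lap_eq_s15]
  exact Finset.sum_congr rfl fun _ _ => by ring

lemma lap_congr {f g : V → ℝ} {x : V} (h0 : f x = g x) (h : ∀ y ∈ N.nb x, f y = g y) :
    N.lap f x = N.lap g x := by
  simp only [lap_eq_s15]
  exact Finset.sum_congr rfl fun y hy => by rw [h0, h y hy]

lemma lap_mono {f g : V → ℝ} {x : V} (h0 : f x = g x) (h : ∀ y, f y ≤ g y) :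
    N.lap f x ≤ N.lap g x := by
  simp only [lap_eq_s15]
  refine Finset.sum_le_sum fun y _ => mul_le_mul_of_nonneg_left ?_ (N.nonneg x y)
  rw [h0]; linarith [h y]

/-- The Laplacian at a vertex, as a linear functional. -/
noncomputable def lapL (x : V) : (V → ℝ) →ₗ[ℝ] ℝ where
  toFun f := N.lap f x
  map_add' f g := N.lap_add f g x
  map_smul' a f := N.lap_smul a f x

/-- Pairing of a finitely supported function with a function. -/
noncomputable def pr (f : V →₀ ℝ) (g : V → ℝ) : ℝ := Finsupp.linearCombination ℝ g f

lemma pr_eq (f : V →₀ ℝ) (g : V → ℝ) : pr f g = ∑ x ∈ f.support, f x * g x := by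
  simp [pr, Finsupp.linearCombination_apply, Finsupp.sum]

lemma pr_eq' (f : V →₀ ℝ) (g : V → ℝ) {F : Finset V} (hF : f.support ⊆ F) :
    pr f g = ∑ x ∈ F, f x * g x := by
  rw [pr_eq]
  refine Finset.sum_subset hF fun x _ hx => ?_
  rw [Finsupp.notMem_support_iff.1 hx, zero_mul]

lemma pr_add_left (f f' : V →₀ ℝ) (g : V → ℝ) : pr (f + f') g = pr f g + pr f' g := by
  simp [pr]

lemma pr_smul_left (a : ℝ) (f : V →₀ ℝ) (g : V → ℝ) : pr (a • f) g = a * pr f g := by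
  simp [pr]

lemma pr_add_right (f : V →₀ ℝ) (g g' : V → ℝ) : pr f (g + g') = pr f g + pr f g' := by
  simp [pr_eq, mul_add, Finset.sum_add_distrib]

lemma pr_smul_right (a : ℝ) (f : V →₀ ℝ) (g : V → ℝ) : pr f (a • g) = a * pr f g := by
  simp only [pr_eq, Finset.mul_sum, Pi.smul_apply, smul_eq_mul]
  exact Finset.sum_congr rfl fun _ _ => by ring

/-- Representing vector of the Laplacian at a vertex. -/
noncomputable def D (x : V) : V →₀ ℝ :=
  ∑ y ∈ N.nb x, N.c x y • (Finsupp.single y 1 - Finsupp.single x 1)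

lemma pr_D (x : V) (g : V → ℝ) : pr (N.D x) g = N.lap g x := by
  simp [pr, D, lap_eq_s15]

/-- The Laplacian of a finitely supported function. -/
noncomputable def lapF (f : V →₀ ℝ) : V →₀ ℝ := Finsupp.linearCombination ℝ N.D f

lemma pr_lapF (f : V →₀ ℝ) (g : V → ℝ) : pr (N.lapF f) g = pr f (N.lap g) := by
  induction f using Finsupp.induction_linear with
  | zero => simp [pr, lapF]
  | add f f' h h' =>
    rw [pr_add_left, ← h, ← h', ← pr_add_left]
    simp [lapF]
  | single x a =>
    have : N.lapF (Finsupp.single x a) = a • N.D x := by simp [lapF]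
    rw [this, pr_smul_left, pr_D]
    simp [pr]

lemma D_apply (x y : V) : N.D x y = N.lap (Finsupp.single x (1:ℝ)) y := by
  rw [D, lap_eq_s15]
  simp only [Finsupp.finsetSum_apply, Finsupp.smul_apply, Finsupp.sub_apply, smul_eq_mul,
    mul_sub, Finset.sum_sub_distrib, ← Finset.sum_mul]
  congr 1
  · simp only [Finsupp.single_apply, mul_ite, mul_one, mul_zero, Finset.sum_ite_eq,
      Finset.sum_ite_eq']
    simp only [mem_nb, N.symm x y]
  · by_cases h : x = y
    · subst h; rfl
    · simp [Finsupp.single_apply, h]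

lemma lapF_apply (f : V →₀ ℝ) (y : V) : N.lapF f y = N.lap f y := by
  induction f using Finsupp.induction_linear with
  | zero => simp [lapF, lap_eq_s15]
  | add f f' h h' =>
    rw [Finsupp.coe_add, lap_add, ← h, ← h', ← Finsupp.add_apply]
    simp [lapF]
  | single x a =>
    have : N.lapF (Finsupp.single x a) = a • N.D x := by simp [lapF]
    have h2 : (Finsupp.single x a : V →₀ ℝ) = a • Finsupp.single x (1:ℝ) := by simp
    rw [this, Finsupp.smul_apply, D_apply, h2, Finsupp.coe_smul, lap_smul, smul_eq_mul]

lemma pr_comm (f g : V →₀ ℝ) : pr f g = pr g f := by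
  rw [pr_eq' f g (F := f.support ∪ g.support) Finset.subset_union_left,
    pr_eq' g f (F := f.support ∪ g.support) Finset.subset_union_right]
  exact Finset.sum_congr rfl fun _ _ => mul_comm _ _

lemma lapF_coe (f : V →₀ ℝ) : (N.lapF f : V → ℝ) = N.lap f := funext (N.lapF_apply f)

/-- The Dirichlet form. -/
noncomputable def B (f g : V →₀ ℝ) : ℝ := - pr f (N.lap g)

lemma B_comm (f g : V →₀ ℝ) : N.B f g = N.B g f := by
  unfold B
  rw [← pr_lapF, pr_comm, lapF_coe]

lemma B_nonneg (f : V →₀ ℝ) : 0 ≤ N.B f f := by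
  set F := f.support ∪ f.support.biUnion N.nb with hF
  have h1 : pr f (N.lap f) = ∑ x ∈ F, ∑ y ∈ F, f x * (N.c x y * (f y - f x)) := by
    rw [pr_eq' f _ (F := F) Finset.subset_union_left]
    refine Finset.sum_congr rfl fun x _ => ?_
    by_cases hx : f x = 0
    · simp [hx]
    · rw [lap_eq_s15, Finset.mul_sum]
      refine Finset.sum_subset ?_ ?_
      · intro y hy
        refine Finset.mem_union_right _ (Finset.mem_biUnion.2 ⟨x, ?_, hy⟩)
        simpa using hx
      · intro y _ hy
        rw [N.c_eq_zero hy]; ring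
  have h2 : pr f (N.lap f) = ∑ x ∈ F, ∑ y ∈ F, f y * (N.c x y * (f x - f y)) := by
    rw [h1, Finset.sum_comm]
    refine Finset.sum_congr rfl fun x _ => Finset.sum_congr rfl fun y _ => ?_
    rw [N.symm]
  have h3 : pr f (N.lap f) + pr f (N.lap f)
      = - ∑ x ∈ F, ∑ y ∈ F, N.c x y * (f x - f y) ^ 2 := by
    nth_rewrite 1 [h1]
    rw [h2]
    simp only [← Finset.sum_add_distrib, ← Finset.sum_neg_distrib]
    refine Finset.sum_congr rfl fun x _ => Finset.sum_congr rfl fun y _ => ?_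
    ring
  have h4 : 0 ≤ ∑ x ∈ F, ∑ y ∈ F, N.c x y * (f x - f y) ^ 2 :=
    Finset.sum_nonneg fun x _ => Finset.sum_nonneg fun y _ =>
      mul_nonneg (N.nonneg x y) (sq_nonneg _)
  unfold B
  linarith

lemma lap_add_fun (f g : V → ℝ) : N.lap (f + g) = N.lap f + N.lap g :=
  funext fun x => N.lap_add f g x

lemma lap_smul_fun (a : ℝ) (f : V → ℝ) : N.lap (a • f) = a • N.lap f :=
  funext fun x => N.lap_smul a f x

lemma B_add_left (f g k : V →₀ ℝ) : N.B (f + g) k = N.B f k + N.B g k := by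
  simp only [B, pr_add_left]; ring

lemma B_smul_left (a : ℝ) (f k : V →₀ ℝ) : N.B (a • f) k = a * N.B f k := by
  simp only [B, pr_smul_left]; ring

lemma B_add_self (f g : V →₀ ℝ) :
    N.B (f + g) (f + g) = N.B f f + 2 * N.B f g + N.B g g := by
  rw [B_add_left, N.B_comm f (f + g), N.B_comm g (f + g), B_add_left, B_add_left,
    N.B_comm g f]; ring

lemma B_smul_self (a : ℝ) (f : V →₀ ℝ) : N.B (a • f) (a • f) = a ^ 2 * N.B f f := by
  rw [B_smul_left, B_comm, B_smul_left]; ring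

lemma B_cauchy (f g : V →₀ ℝ) : N.B f g ^ 2 ≤ N.B f f * N.B g g := by
  have key : ∀ t : ℝ, 0 ≤ N.B g g * (t * t) + (2 * N.B f g) * t + N.B f f := by
    intro t
    have := N.B_nonneg (f + t • g)
    rw [B_add_self, B_smul_self, N.B_comm f (t • g), B_smul_left, N.B_comm g f] at this
    linarith
  have := discrim_le_zero key
  unfold discrim at this
  nlinarith

/-! ### Test functions from recurrence -/

lemma pstep_nonneg (n : ℕ) (x y : V) : 0 ≤ N.pstep n x y := by
  induction n generalizing y with
  | zero => unfold pstep; split_ifs <;> norm_num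
  | succ n ih =>
    unfold pstep
    exact tsum_nonneg fun z => mul_nonneg (ih z) (div_nonneg (N.nonneg _ _) (N.cTot_pos z).le)

lemma pstep_succ (n : ℕ) (x y : V) :
    N.pstep (n + 1) x y = ∑ z ∈ N.nb y, N.c y z * (N.pstep n x z / N.cTot z) := by
  have : N.pstep (n + 1) x y = ∑' z, N.pstep n x z * N.p z y := rfl
  rw [this, tsum_eq_sum (s := N.nb y)]
  · refine Finset.sum_congr rfl fun z _ => ?_
    rw [p, N.symm z y]; ring
  · intro z hz
    rw [p, N.symm z y, N.c_eq_zero hz]; simp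

lemma pstep_finite (n : ℕ) (x : V) : (Function.support (N.pstep n x)).Finite := by
  induction n with
  | zero =>
    refine (Set.finite_singleton x).subset fun y hy => ?_
    by_contra h
    apply hy
    have : x ≠ y := fun h' => h h'.symm
    simp [pstep, this]
  | succ n ih =>
    refine (ih.biUnion fun z _ => (N.nb z).finite_toSet).subset fun y hy => ?_
    rw [Function.mem_support, pstep_succ] at hy
    obtain ⟨z, hz, h⟩ := Finset.exists_ne_zero_of_sum_ne_zero hy
    simp only [Set.mem_iUnion]
    refine ⟨z, ?_, ?_⟩
    · intro h0; apply h; rw [h0]; simp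
    · rw [Finset.mem_coe, mem_nb, N.symm, ← mem_nb]; exact hz

/-- `p_n(x,·)/c_·` as a finitely supported function. -/
noncomputable def qf (x : V) (n : ℕ) : V →₀ ℝ :=
  Finsupp.ofSupportFinite (fun y => N.pstep n x y / N.cTot y)
    ((N.pstep_finite n x).subset fun y hy h => hy (by simp [h]))

lemma qf_apply (x : V) (n : ℕ) (y : V) : N.qf x n y = N.pstep n x y / N.cTot y := rfl

lemma lap_qf (x : V) (n : ℕ) (y : V) :
    N.lap (N.qf x n) y = N.pstep (n + 1) x y - N.pstep n x y := by
  rw [lap_eq_s15, pstep_succ]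
  simp only [qf_apply, mul_sub, Finset.sum_sub_distrib, ← Finset.sum_mul]
  rw [← cTot_eq, mul_div_cancel₀ _ (N.cTot_pos y).ne']

lemma lap_sum_qf (x : V) (n : ℕ) (y : V) :
    N.lap (∑ i ∈ Finset.range n, N.qf x i : V →₀ ℝ) y = N.pstep n x y - N.pstep 0 x y := by
  induction n with
  | zero => simp [lap_eq_s15]
  | succ n ih =>
    rw [Finset.sum_range_succ, Finsupp.coe_add, lap_add, ih, lap_qf]; ring

lemma exists_test (hrec : N.Recurrent) (o : V) (ε : ℝ) (hε : 0 < ε) :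
    ∃ φ : V →₀ ℝ, φ o = 1 ∧ N.B φ φ < ε := by
  have hnn : ∀ n, 0 ≤ N.pstep n o o := fun n => N.pstep_nonneg n o o
  have hdiv := (not_summable_iff_tendsto_nat_atTop_of_nonneg hnn).1 (hrec o)
  have hc := N.cTot_pos o
  obtain ⟨n, hn⟩ := (hdiv.eventually_gt_atTop (N.cTot o / ε)).exists
  set f : V →₀ ℝ := ∑ i ∈ Finset.range n, N.qf o i with hf
  have hfo : f o = (∑ i ∈ Finset.range n, N.pstep i o o) / N.cTot o := by
    rw [hf, Finsupp.finsetSum_apply, Finset.sum_div]; rfl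
  have hfn : ∀ x, 0 ≤ f x := by
    intro x
    rw [hf, Finsupp.finsetSum_apply]
    exact Finset.sum_nonneg fun i _ => div_nonneg (N.pstep_nonneg _ _ _) (N.cTot_pos x).le
  have hbig : 1 / ε < f o := by
    rw [hfo, lt_div_iff₀ hc]
    calc 1 / ε * N.cTot o = N.cTot o / ε := by ring
      _ < _ := hn
  have hpos : 0 < f o := lt_trans (by positivity) hbig
  have hB : N.B f f ≤ f o := by
    unfold B
    rw [pr_eq' f _ (F := insert o f.support) (Finset.subset_insert _ _),
      ← Finset.sum_neg_distrib]
    calc ∑ x ∈ insert o f.support, -(f x * N.lap f x)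
        ≤ ∑ x ∈ insert o f.support, (if o = x then f x else 0) := by
          refine Finset.sum_le_sum fun x _ => ?_
          rw [hf, lap_sum_qf, ← hf]
          have h1 := mul_nonneg (hfn x) (N.pstep_nonneg n o x)
          have h2 : N.pstep 0 o x = if o = x then 1 else 0 := rfl
          rw [h2]
          split_ifs <;> linarith
      _ = f o := by simp
  refine ⟨(f o)⁻¹ • f, by simp [hpos.ne'], ?_⟩
  rw [B_smul_self]
  have : (f o)⁻¹ ^ 2 * N.B f f ≤ (f o)⁻¹ := by
    calc (f o)⁻¹ ^ 2 * N.B f f ≤ (f o)⁻¹ ^ 2 * f o := by gcongr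
      _ = (f o)⁻¹ := by field_simp
  refine this.trans_lt ?_
  rw [inv_lt_comm₀ hpos hε]
  simpa using hbig

/-! ### Minimum principle and Harnack bounds -/

lemma nb_eq_of_min {f : V → ℝ} {x : V} (hl : N.lap f x ≤ 0) (hm : ∀ y ∈ N.nb x, f x ≤ f y) :
    ∀ y ∈ N.nb x, f y = f x := by
  intro y hy
  rw [lap_eq_s15] at hl
  have hnn : ∀ z ∈ N.nb x, 0 ≤ N.c x z * (f z - f x) := fun z hz =>
    mul_nonneg (N.nonneg x z) (sub_nonneg.2 (hm z hz))
  have h0 := le_antisymm hl (Finset.sum_nonneg hnn)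
  have h1 := (Finset.sum_eq_zero_iff_of_nonneg hnn).1 h0 y hy
  have h2 := (N.mem_nb.1 hy).ne'
  rcases mul_eq_zero.1 h1 with h | h
  · exact absurd h h2
  · linarith

lemma propagate {f : V → ℝ} {m : ℝ} {x o : V} (hx : f x = m)
    (H : ∀ z, f z = m → z ≠ o → ∀ y ∈ N.nb z, f y = m) : f o = m := by
  by_contra hne
  have : ∀ y, Relation.ReflTransGen (fun a b => 0 < N.c a b) x y → f y = m := by
    intro y hy
    induction hy with
    | refl => exact hx
    | tail _ hbc ih =>
      refine H _ ih ?_ _ (N.mem_nb.2 hbc)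
      rintro rfl
      exact hne ih
  exact hne (this o (N.conn x o))

/-- A finitely supported function superharmonic off `o` is minimal at `o`. -/
lemma finsupp_min (o : V) (f : V →₀ ℝ) (hf : ∀ x, x ≠ o → N.lap f x ≤ 0) (x : V) :
    f o ≤ f x := by
  by_contra hlt
  push Not at hlt
  have hfin : (Set.range f).Finite := by
    refine ((f.support.image f) ∪ {0}).finite_toSet.subset ?_
    rintro _ ⟨z, rfl⟩
    by_cases hz : f z = 0
    · simp [hz]
    · simp only [Finset.coe_union, Finset.coe_image, Set.mem_union]
      exact Or.inl ⟨z, by simpa using hz, rfl⟩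
  obtain ⟨m, ⟨x0, rfl⟩, hm⟩ := Set.exists_min_image _ id hfin ⟨f x, x, rfl⟩
  have hm' : ∀ y, f x0 ≤ f y := fun y => hm _ ⟨y, rfl⟩
  have : f o = f x0 := by
    refine N.propagate (f := f) (x := x0) rfl fun z hz hzo y hy => ?_
    rw [← hz]
    exact N.nb_eq_of_min (hf z hzo) (fun y _ => hz ▸ hm' y) y hy
  have := hm' x
  linarith

lemma harnack (o v : V) : ∃ C : ℝ, ∃ P : Finset V, ∀ h : V → ℝ, (∀ x, 0 ≤ h x) → h o = 0 →
    (∀ x ∈ P, N.lap h x = if x = o then 1 else 0) → h v ≤ C := by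
  induction N.conn o v with
  | refl => exact ⟨0, ∅, fun h _ ho _ => ho.le⟩
  | @tail b d _ hbd ih =>
    obtain ⟨C, P, hCP⟩ := ih
    refine ⟨(1 + N.cTot b * C) / N.c b d, insert b P, fun h h0 ho hl => ?_⟩
    have h1 := hCP h h0 ho fun x hx => hl x (Finset.mem_insert_of_mem hx)
    have h2 : N.lap h b ≤ 1 := by
      rw [hl b (Finset.mem_insert_self _ _)]; split_ifs <;> norm_num
    rw [lap_eq_s15] at h2
    simp only [mul_sub, Finset.sum_sub_distrib, ← Finset.sum_mul, ← cTot_eq] at h2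
    have h3 : N.c b d * h d ≤ ∑ y ∈ N.nb b, N.c b y * h y :=
      Finset.single_le_sum (f := fun y => N.c b y * h y)
        (fun y _ => mul_nonneg (N.nonneg _ _) (h0 y)) (N.mem_nb.2 hbd)
    have h4 : N.cTot b * h b ≤ N.cTot b * C := mul_le_mul_of_nonneg_left h1 (N.cTot_pos b).le
    rw [le_div_iff₀ hbd]
    linarith

lemma isPotential_of {o : V} {h : V → ℝ} (h0 : ∀ x, 0 ≤ h x) (ho : h o = 0)
    (hl : ∀ x, N.lap h x = if x = o then 1 else 0) : N.IsPotential o h :=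
  ⟨h0, ho, by simp [hl], fun v hv => by simp [hl, hv]⟩

lemma IsPotential.lap_ite {N : Network V} {o : V} {h : V → ℝ} (H : N.IsPotential o h) (x : V) :
    N.lap h x = if x = o then 1 else 0 := by
  split_ifs with hx
  · rw [hx]; exact H.2.2.1
  · exact H.2.2.2 x hx

lemma exists_limit (o : V) (Q : Finset V → V → ℝ) (h0 : ∀ W v, 0 ≤ Q W v)
    (ho : ∀ W, Q W o = 0)
    (hl : ∀ W, ∀ x ∈ W, N.lap (Q W) x = if x = o then 1 else 0) :
    ∃ U : Ultrafilter (Finset V), (U : Filter (Finset V)) ≤ atTop ∧ ∃ w : V → ℝ,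
      N.IsPotential o w ∧ ∀ v, Tendsto (fun W => Q W v) U (𝓝 (w v)) := by
  let U : Ultrafilter (Finset V) := Ultrafilter.of atTop
  have hU : (U : Filter (Finset V)) ≤ atTop := Ultrafilter.of_le _
  have hlim : ∀ v, ∃ a, Tendsto (fun W => Q W v) U (𝓝 a) := by
    intro v
    obtain ⟨C, P, hCP⟩ := N.harnack o v
    have hev : ∀ᶠ W in (U : Filter (Finset V)), Q W v ∈ Set.Icc 0 C := by
      refine hU ((eventually_ge_atTop P).mono fun W hW => ⟨h0 W v, ?_⟩)
      exact hCP _ (h0 W) (ho W) fun x hx => hl W x (hW hx)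
    obtain ⟨a, _, ha⟩ := (isCompact_Icc (a := (0:ℝ)) (b := C)).ultrafilter_le_nhds
      (U.map fun W => Q W v) (le_principal_iff.2 hev)
    exact ⟨a, ha⟩
  choose w hw using hlim
  refine ⟨U, hU, w, N.isPotential_of (fun x => ?_) ?_ (fun x => ?_), hw⟩
  · exact ge_of_tendsto' (hw x) fun W => h0 W x
  · refine tendsto_nhds_unique (hw o) ?_
    simp [ho]
  · have h1 : Tendsto (fun W => N.lap (Q W) x) U (𝓝 (N.lap w x)) := by
      simp only [lap_eq_s15]
      exact tendsto_finsetSum _ fun y _ => ((hw y).sub (hw x)).const_mul _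
    have h2 : Tendsto (fun W => N.lap (Q W) x) U (𝓝 (if x = o then 1 else 0)) := by
      refine tendsto_const_nhds.congr' ?_
      refine hU ((eventually_ge_atTop {x}).mono fun W hW => ?_)
      exact (hl W x (hW (Finset.mem_singleton_self x))).symm
    exact tendsto_nhds_unique h1 h2

/-! ### Duality -/

/-- Turn a function on a finset into a finitely supported function. -/
noncomputable def ext0 (W : Finset V) (b : W → ℝ) : V →₀ ℝ :=
  ∑ x : W, Finsupp.single (x : V) (b x)

lemma pr_ext0 (W : Finset V) (b : W → ℝ) (g : V → ℝ) :
    pr (ext0 W b) g = ∑ x : W, b x * g x := by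
  simp [pr, ext0]

lemma lap_ext0 (W : Finset V) (b : W → ℝ) (y : V) :
    N.lap (ext0 W b) y = ∑ x : W, b x * N.lap (Finsupp.single y (1:ℝ)) x := by
  rw [← pr_ext0 W b (N.lap _), ← pr_lapF, pr_comm, lapF_coe]
  simp [pr]

lemma exists_sol (o : V) (W : Finset V) (hoW : o ∈ W) : ∃ h : V → ℝ, h o = 0 ∧
    ∀ x ∈ W, N.lap h x = if x = o then 1 else 0 := by
  let A : (V → ℝ) →ₗ[ℝ] (W → ℝ) := LinearMap.pi fun x : W => N.lapL x
  let e : W → ℝ := fun x => if (x : V) = o then 1 else 0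
  by_cases he : e ∈ LinearMap.range A
  · obtain ⟨h, hh⟩ := he
    refine ⟨fun y => h y + (- h o), by simp, fun x hx => ?_⟩
    rw [lap_shift]
    exact congrFun hh ⟨x, hx⟩
  · exfalso
    obtain ⟨f, hf, hf'⟩ := Submodule.exists_dual_map_eq_bot_of_notMem he inferInstance
    let b : W → ℝ := fun x => f (Pi.single x 1)
    have hfb : ∀ r : W → ℝ, f r = ∑ x, b x * r x := by
      intro r
      have : r = ∑ x, r x • (Pi.single x (1:ℝ) : W → ℝ) := by
        ext y; simp [Finset.sum_apply, Pi.single_apply]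
      conv_lhs => rw [this]
      rw [map_sum]
      simp only [map_smul, smul_eq_mul]
      exact Finset.sum_congr rfl fun x _ => mul_comm _ _
    have hz : ∀ h, f (A h) = 0 := fun h => by
      have : f (A h) ∈ (LinearMap.range A).map f := ⟨A h, ⟨h, rfl⟩, rfl⟩
      rw [hf'] at this
      simpa using this
    have hlap : ∀ y, N.lap (ext0 W b) y = 0 := by
      intro y
      rw [lap_ext0, ← hz (Finsupp.single y (1:ℝ)), hfb]; rfl
    have hbo : ext0 W b o ≠ 0 := by
      have : ext0 W b o = f e := by
        rw [hfb, ext0]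
        simp [e, Finsupp.single_apply]
      rwa [this]
    have h1 := N.finsupp_min o (ext0 W b) fun x _ => (hlap x).le
    have h2 := N.finsupp_min o (-(ext0 W b)) fun x _ => by
      have : ((-(ext0 W b) : V →₀ ℝ) : V → ℝ) = (-1 : ℝ) • (ext0 W b : V → ℝ) := by
        ext; simp
      rw [this, lap_smul, hlap]; simp
    haveI := N.infinite
    obtain ⟨z, hz⟩ := Infinite.exists_notMem_finset (ext0 W b).support
    have h3 := h1 z
    have h4 := h2 z
    simp only [Finsupp.notMem_support_iff.1 hz, Finsupp.neg_apply] at h3 h4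
    exact hbo (by linarith)

/-- Feasibility can be checked on a finite set of inequalities. -/
lemma feasible_of (o : V) (M : ℝ) (hM : 0 < M) (W W' : Finset V) (hoW : o ∈ W) (hWW : W ⊆ W')
    (h : V → ℝ) (ho : h o = 0) (hl : ∀ x ∈ W', N.lap h x = if x = o then 1 else 0)
    (hS : ∀ x ∈ (W' ∪ W'.biUnion N.nb) \ W, M ≤ h x) :
    ∃ h : V → ℝ, (∀ x, 0 ≤ h x) ∧ h o = 0 ∧
      (∀ x ∈ W', N.lap h x = if x = o then 1 else 0) ∧ ∀ x ∉ W, M ≤ h x := by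
  set F := W' ∪ W'.biUnion N.nb with hF
  have hW'F : ∀ x ∈ W', x ∈ F := fun x hx => Finset.mem_union_left _ hx
  have hnF : ∀ x ∈ W', ∀ y ∈ N.nb x, y ∈ F := fun x hx y hy =>
    Finset.mem_union_right _ (Finset.mem_biUnion.2 ⟨x, hx, hy⟩)
  let k : V → ℝ := fun x => if x ∈ F then h x else M
  have hk : ∀ x ∈ F, k x = h x := fun x hx => if_pos hx
  have hko : k o = 0 := by rw [hk o (hW'F o (hWW hoW)), ho]
  have hkl : ∀ x ∈ W', N.lap k x = if x = o then 1 else 0 := fun x hx => by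
    rw [← hl x hx]
    exact N.lap_congr (hk x (hW'F x hx)) fun y hy => hk y (hnF x hx y hy)
  have hkM : ∀ x ∉ W, M ≤ k x := fun x hx => by
    by_cases hxF : x ∈ F
    · rw [hk x hxF]; exact hS x (Finset.mem_sdiff.2 ⟨hxF, hx⟩)
    · simp [k, hxF]
  refine ⟨k, ?_, hko, hkl, hkM⟩
  by_contra hneg
  push Not at hneg
  obtain ⟨x, hx⟩ := hneg
  obtain ⟨x0, hx0, hmin⟩ := W.exists_min_image k ⟨o, hoW⟩
  have hxW : x ∈ W := by
    by_contra hxW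
    have := hkM x hxW
    linarith
  have hx0neg : k x0 < 0 := (hmin x hxW).trans_lt hx
  have hmin' : ∀ y, k x0 ≤ k y := fun y => by
    by_cases hy : y ∈ W
    · exact hmin y hy
    · have := hkM y hy
      linarith
  have : k o = k x0 := by
    refine N.propagate (f := k) (x := x0) rfl fun z hz hzo y hy => ?_
    have hzW : z ∈ W := by
      by_contra hzW
      have := hkM z hzW
      linarith
    rw [← hz]
    refine N.nb_eq_of_min ?_ (fun y _ => hz ▸ hmin' y) y hy
    rw [hkl z (hWW hzW)]
    simp [hzo]
  linarith

/-- Farkas alternative on a finite subsystem. -/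
lemma farkas (o : V) (M : ℝ) (W' S : Finset V) (hoW : o ∈ W') (hoS : o ∉ S)
    (hinf : ¬ ∃ h : V → ℝ, h o = 0 ∧ (∀ x ∈ W', N.lap h x = if x = o then 1 else 0) ∧
      ∀ x ∈ S, M ≤ h x) :
    ∃ u : V →₀ ℝ, N.lap u o = 1 ∧ (∀ x, x ≠ o → N.lap u x ≤ 0) ∧
      (∀ x, x ≠ o → x ∉ S → N.lap u x = 0) ∧ - u o ≤ M := by
  obtain ⟨h1, h1o, h1l⟩ := N.exists_sol o W' hoW
  let X : Set (V → ℝ) := {h | h o = 0 ∧ ∀ x ∈ W', N.lap h x = if x = o then 1 else 0}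
  let R : (V → ℝ) →ₗ[ℝ] (S → ℝ) := LinearMap.funLeft ℝ ℝ (fun x : S => (x : V))
  have hR : ∀ h x, R h x = h x := fun _ _ => rfl
  let O : Set (S → ℝ) := Set.univ.pi fun _ => Set.Ioi M
  have hOc : Convex ℝ O := convex_pi fun _ _ => convex_Ioi M
  have hOo : IsOpen O := isOpen_set_pi Set.finite_univ fun _ _ => isOpen_Ioi
  have hXc : Convex ℝ X := by
    rintro f ⟨hf, hf'⟩ g ⟨hg, hg'⟩ a b _ _ hab
    refine ⟨by simp [hf, hg], fun x hx => ?_⟩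
    rw [lap_add, lap_smul, lap_smul, hf' x hx, hg' x hx, ← add_mul, hab, one_mul]
  have hdisj : Disjoint O (R '' X) := by
    rw [Set.disjoint_left]
    rintro _ hr ⟨h, ⟨ho, hl⟩, rfl⟩
    exact hinf ⟨h, ho, hl, fun x hx => (hr ⟨x, hx⟩ (Set.mem_univ _)).le⟩
  obtain ⟨g, s, hg1, hg2⟩ := geometric_hahn_banach_open hOc hOo (hXc.linear_image R) hdisj
  let μ : S → ℝ := fun x => - g (Pi.single x 1)
  have hgμ : ∀ r : S → ℝ, g r = - ∑ x, μ x * r x := by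
    intro r
    have : r = ∑ x, r x • (Pi.single x (1:ℝ) : S → ℝ) := by
      ext y; simp [Finset.sum_apply, Pi.single_apply]
    conv_lhs => rw [this]
    rw [map_sum, ← Finset.sum_neg_distrib]
    simp only [map_smul, smul_eq_mul, μ]
    exact Finset.sum_congr rfl fun x _ => by ring
  have hμ0 : ∀ x, 0 ≤ μ x := by
    intro x
    by_contra hneg
    push Not at hneg
    let a := g (fun _ => M + 1)
    have hgx : 0 < g (Pi.single x 1) := by simpa [μ] using hneg
    obtain ⟨t, ht⟩ := exists_nat_gt ((s - a) / g (Pi.single x 1))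
    have hmem : (fun _ => M + 1) + (t : ℝ) • (Pi.single x (1:ℝ) : S → ℝ) ∈ O := by
      intro y _
      have : (0:ℝ) ≤ (t : ℝ) * (Pi.single x (1:ℝ) : S → ℝ) y := by
        refine mul_nonneg (Nat.cast_nonneg _) ?_
        rw [Pi.single_apply]; split_ifs <;> norm_num
      simp only [Pi.add_apply, Pi.smul_apply, smul_eq_mul, Set.mem_Ioi]
      linarith
    have h2 := hg1 _ hmem
    rw [map_add, map_smul, smul_eq_mul] at h2
    rw [div_lt_iff₀ hgx] at ht
    change a + _ < s at h2
    linarith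
  have hbound : ∀ h ∈ X, ∑ x : S, μ x * h x ≤ M * ∑ x, μ x := by
    intro h hh
    have h2 := hg2 _ ⟨h, hh, rfl⟩
    rw [hgμ] at h2
    simp only [hR] at h2
    refine le_of_forall_pos_le_add fun ε hε => ?_
    obtain ⟨δ, hδ, hδ'⟩ : ∃ δ : ℝ, 0 < δ ∧ δ * ∑ x, μ x ≤ ε := by
      have hs : 0 ≤ ∑ x, μ x := Finset.sum_nonneg fun x _ => hμ0 x
      refine ⟨ε / (1 + ∑ x, μ x), by positivity, ?_⟩
      rw [div_mul_eq_mul_div, div_le_iff₀ (by positivity)]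
      nlinarith
    have h3 := hg1 (fun _ => M + δ) fun _ _ => by simp [hδ]
    rw [hgμ, ← Finset.sum_mul] at h3
    linarith
  have hμs : 0 < ∑ x, μ x := by
    refine lt_of_le_of_ne (Finset.sum_nonneg fun x _ => hμ0 x) fun h0 => ?_
    have hall := (Finset.sum_eq_zero_iff_of_nonneg fun x _ => hμ0 x).1 h0.symm
    have hg0 : ∀ r, g r = 0 := fun r => by
      rw [hgμ, Finset.sum_eq_zero, neg_zero]
      intro x hx; rw [hall x hx, zero_mul]
    have h3 := hg1 (fun _ => M + 1) fun _ _ => by simp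
    have h4 := hg2 _ ⟨h1, ⟨h1o, h1l⟩, rfl⟩
    rw [hg0] at h3 h4
    linarith
  let ψ : (V → ℝ) →ₗ[ℝ] ℝ :=
    ∑ x : S, μ x • (LinearMap.proj (x : V) - LinearMap.proj (R := ℝ) (φ := fun _ : V => ℝ) o)
  have hψ : ∀ h, ψ h = ∑ x : S, μ x * (h x - h o) := fun h => by simp [ψ]
  have hker : ⨅ x : W', LinearMap.ker (N.lapL (x : V)) ≤ LinearMap.ker ψ := by
    intro h hh
    simp only [Submodule.mem_iInf, LinearMap.mem_ker] at hh ⊢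
    have hlin : ∀ t : ℝ, ψ h1 + t * ψ h ≤ M * ∑ x, μ x := by
      intro t
      have := hbound (fun y => (h1 + t • h) y + (- t * h o)) ⟨by simp [h1o], fun x hx => by
        rw [lap_shift, lap_add, lap_smul, h1l x hx]
        have : N.lap h x = 0 := hh ⟨x, hx⟩
        rw [this]; ring⟩
      refine le_trans (le_of_eq ?_) this
      rw [hψ, hψ, Finset.mul_sum, ← Finset.sum_add_distrib]
      refine Finset.sum_congr rfl fun x _ => ?_
      simp only [Pi.add_apply, Pi.smul_apply, smul_eq_mul, h1o]; ring
    by_contra hne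
    have := hlin ((M * ∑ x, μ x - ψ h1 + 1) / ψ h)
    rw [div_mul_cancel₀ _ hne] at this
    linarith
  obtain ⟨b, hb⟩ := (Submodule.mem_span_range_iff_exists_fun ℝ).1
    (mem_span_of_iInf_ker_le_ker hker)
  have hbψ : ∀ h, ψ h = ∑ x : W', b x * N.lap h x := fun h => by
    rw [← hb]; simp [lapL]
  have hlapb : ∀ y, N.lap (ext0 W' b) y = ψ (Finsupp.single y (1:ℝ)) := fun y => by
    rw [lap_ext0, hbψ]
  set m := ∑ x, μ x with hm
  have hu : ∀ y, N.lap ((-m⁻¹) • ext0 W' b : V →₀ ℝ) y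
      = -m⁻¹ * ψ (Finsupp.single y (1:ℝ)) := fun y => by
    rw [Finsupp.coe_smul, lap_smul, hlapb]
  refine ⟨(-m⁻¹) • ext0 W' b, ?_, ?_, ?_, ?_⟩
  · rw [hu, hψ]
    have : ∑ x : S, μ x * ((Finsupp.single o (1:ℝ)) (x : V) - (Finsupp.single o (1:ℝ)) o)
        = - m := by
      rw [hm, ← Finset.sum_neg_distrib]
      refine Finset.sum_congr rfl fun x _ => ?_
      have : o ≠ (x : V) := fun h => hoS (h ▸ x.2)
      simp [Finsupp.single_apply, this]
    rw [this]; field_simp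
  · intro y hy
    rw [hu, hψ]
    have : 0 ≤ ∑ x : S, μ x * ((Finsupp.single y (1:ℝ)) (x : V) - (Finsupp.single y (1:ℝ)) o) := by
      refine Finset.sum_nonneg fun x _ => mul_nonneg (hμ0 x) ?_
      simp only [Finsupp.single_apply, hy, if_false, sub_zero]
      split_ifs <;> norm_num
    have hmi : 0 < m⁻¹ := inv_pos.2 hμs
    nlinarith
  · intro y hy hyS
    rw [hu, hψ, Finset.sum_eq_zero, mul_zero]
    intro x _
    have : y ≠ (x : V) := fun h => hyS (h ▸ x.2)
    simp [Finsupp.single_apply, hy, this]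
  · have h2 := hbound h1 ⟨h1o, h1l⟩
    have h3 : ψ h1 = ext0 W' b o := by
      rw [hbψ, ext0, Finsupp.finsetSum_apply]
      refine Finset.sum_congr rfl fun x _ => ?_
      rw [h1l x x.2, Finsupp.single_apply]
      split_ifs <;> simp
    have h4 : ψ h1 = ∑ x : S, μ x * h1 x := by rw [hψ]; simp [h1o]
    rw [← h4, h3] at h2
    simp only [Finsupp.smul_apply, smul_eq_mul]
    have : m⁻¹ * ext0 W' b o ≤ M := by
      rw [inv_mul_le_iff₀ hμs]; linarith
    linarith

lemma dual (o : V) (M : ℝ) (hM : 0 < M) (W : Finset V) (hoW : o ∈ W)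
    (hno : ¬ ∃ h, N.IsPotential o h ∧ ∀ x ∉ W, M ≤ h x) :
    ∃ u : V →₀ ℝ, N.lap u o = 1 ∧ (∀ x, x ≠ o → N.lap u x ≤ 0) ∧
      (∀ x ∈ W, N.lap u x = if x = o then 1 else 0) ∧ - u o ≤ M := by
  by_cases hfeas : ∀ W' : Finset V, ∃ h : V → ℝ, (∀ x, 0 ≤ h x) ∧ h o = 0 ∧
      (∀ x ∈ W', N.lap h x = if x = o then 1 else 0) ∧ ∀ x ∉ W, M ≤ h x
  · exfalso
    choose Q hQ0 hQo hQl hQM using hfeas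
    obtain ⟨U, hU, w, hw, hlim⟩ := N.exists_limit o Q hQ0 hQo hQl
    exact hno ⟨w, hw, fun x hx => ge_of_tendsto' (hlim x) fun W' => hQM W' x hx⟩
  · push Not at hfeas
    obtain ⟨W₀, hW₀⟩ := hfeas
    set W' := W ∪ W₀ with hW'
    obtain ⟨u, hu1, hu2, hu3, hu4⟩ := N.farkas o M W' ((W' ∪ W'.biUnion N.nb) \ W)
      (Finset.mem_union_left _ hoW) (by simp [hoW]) (by
        rintro ⟨h, ho, hl, hS⟩
        obtain ⟨k, hk0, hko, hkl, hkM⟩ := N.feasible_of o M hM W W' hoW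
          Finset.subset_union_left h ho hl hS
        obtain ⟨x, hx, hx'⟩ := hW₀ k hk0 hko fun x hx => hkl x (Finset.mem_union_right _ hx)
        exact absurd (hkM x hx) (not_le.2 hx'))
    refine ⟨u, hu1, hu2, fun x hx => ?_, hu4⟩
    split_ifs with hxo
    · rw [hxo, hu1]
    · exact hu3 x hxo (by simp [hx])

/-! ### The energy argument -/

lemma pr_lapF_shift (f : V →₀ ℝ) (g : V → ℝ) (a : ℝ) :
    pr (N.lapF f) (fun x => g x + a) = pr (N.lapF f) g := by
  rw [pr_lapF, pr_lapF]
  congr 1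
  exact funext fun x => N.lap_shift g a x

lemma B_eq_lapF (f g : V →₀ ℝ) : N.B f g = - pr (N.lapF f) g := by
  rw [B, pr_lapF]

/-- The inductive construction of functions with a large flux and controlled energy. -/
lemma energy_step (o : V) (M L : ℝ) (T : Finset V) (w : V → ℝ)
    (hw : N.IsPotential o w) (U : Ultrafilter (Finset V)) (τ : Finset V → V →₀ ℝ)
    (a : Finset V → ℝ) (haM : ∀ W, a W ≤ M) (hτo : ∀ W, τ W o = - a W)
    (hτl : ∀ W x, x ≠ o → N.lap (τ W) x ≤ 0)
    (hτT : ∀ᶠ W in (U : Filter (Finset V)), ∀ x ∈ T, N.lap (τ W) x = if x = o then 1 else 0)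
    (hτE : ∀ᶠ W in (U : Filter (Finset V)), N.B (τ W) (τ W) ≤ L)
    (hlim : ∀ x, Tendsto (fun W => τ W x + a W) U (𝓝 (min (w x) L))) (hL : 0 ≤ L)
    (hM : 0 ≤ M) (k : ℕ) :
    ∃ s : V →₀ ℝ, (∀ x, x ≠ o → N.lap s x ≤ 0) ∧
      (∀ x ∈ T, N.lap s x = k * if x = o then 1 else 0) ∧ - s o ≤ k * M ∧
      N.B s s ≤ k * L + k ^ 2 * (M + 1) := by
  induction k with
  | zero => exact ⟨0, by simp [lap_eq_s15], by simp [lap_eq_s15], by simp, by simp [B, pr]⟩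
  | succ k ih =>
    obtain ⟨s, hs1, hs2, hs3, hs4⟩ := ih
    have ht : Tendsto (fun W => N.B s (τ W)) U
        (𝓝 (- pr (N.lapF s) (fun x => min (w x) L))) := by
      have : ∀ W, N.B s (τ W) = - pr (N.lapF s) (fun x => τ W x + a W) := fun W => by
        rw [pr_lapF_shift, B_eq_lapF]
      simp only [this, pr_eq]
      exact (tendsto_finsetSum _ fun x _ => (hlim x).const_mul _).neg
    have hle : - pr (N.lapF s) (fun x => min (w x) L) ≤ k * M := by
      calc - pr (N.lapF s) (fun x => min (w x) L) ≤ - pr (N.lapF s) w := by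
            simp only [pr_eq, ← Finset.sum_neg_distrib]
            refine Finset.sum_le_sum fun x _ => ?_
            rw [lapF_apply]
            by_cases hx : x = o
            · rw [hx, hw.2.1, min_eq_left hL]
            · have := hs1 x hx
              have := min_le_left (w x) L
              nlinarith
        _ = - s o := by
            rw [pr_lapF, pr_eq' s _ (F := insert o s.support) (Finset.subset_insert _ _)]
            simp [hw.lap_ite]
        _ ≤ k * M := hs3
    have hev : ∀ᶠ W in (U : Filter (Finset V)), N.B s (τ W) < k * M + 1 / 2 :=
      ht.eventually_lt_const (by linarith)
    obtain ⟨W, hW1, hW2, hW3⟩ := (hev.and (hτT.and hτE)).exists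
    refine ⟨s + τ W, fun x hx => ?_, fun x hx => ?_, ?_, ?_⟩
    · rw [Finsupp.coe_add, lap_add]
      linarith [hs1 x hx, hτl W x hx]
    · rw [Finsupp.coe_add, lap_add, hs2 x hx, hW2 x hx]
      push_cast; ring
    · rw [Finsupp.add_apply, hτo]
      push_cast
      linarith [haM W]
    · rw [B_add_self]
      push_cast
      have hk : (0:ℝ) ≤ k := Nat.cast_nonneg k
      nlinarith

lemma exists_large (hrec : N.Recurrent) (o : V) (M : ℝ) (hM : 0 < M) :
    ∃ (h : V → ℝ) (W : Finset V), N.IsPotential o h ∧ ∀ x ∉ W, M ≤ h x := by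
  by_contra hcon
  have hno : ∀ W : Finset V, ¬ ∃ h, N.IsPotential o h ∧ ∀ x ∉ insert o W, M ≤ h x :=
    fun W ⟨h, hh⟩ => hcon ⟨h, insert o W, hh⟩
  choose u hu1 hu2 hu3 hu4 using
    fun W : Finset V => N.dual o M hM (insert o W) (Finset.mem_insert_self o W) (hno W)
  let v : Finset V → V → ℝ := fun W x => u W x + (- u W o)
  have hv0 : ∀ W x, 0 ≤ v W x := fun W x => by
    have := N.finsupp_min o (u W) (hu2 W) x
    simp only [v]; linarith
  have hvo : ∀ W, v W o = 0 := fun W => by simp [v]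
  have hvl : ∀ W, ∀ x ∈ W, N.lap (v W) x = if x = o then 1 else 0 := fun W x hx => by
    rw [lap_shift, hu3 W x (Finset.mem_insert_of_mem hx)]
  obtain ⟨U, hU, w, hw, hlim⟩ := N.exists_limit o v hv0 hvo hvl
  obtain ⟨φ, hφo, hφE⟩ := N.exists_test hrec o (1 / (M + 2)) (by positivity)
  choose C P hCP using N.harnack o
  set T := φ.support with hT
  set F := T ∪ T.biUnion N.nb with hF
  set L : ℝ := M + ∑ x ∈ F, |C x| with hLdef
  have hsum : 0 ≤ ∑ x ∈ F, |C x| := Finset.sum_nonneg fun _ _ => abs_nonneg _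
  have hLM : M ≤ L := by linarith
  have hL : 0 ≤ L := by linarith
  have haL : ∀ W, 0 ≤ L - (- u W o) := fun W => by linarith [hu4 W]
  let τ : Finset V → V →₀ ℝ := fun W =>
    (u W).mapRange (fun r => min r (L - (- u W o))) (min_eq_left (haL W))
  have hτ : ∀ W x, τ W x = min (u W x) (L - (- u W o)) := fun W x => by simp [τ]
  have hτv : ∀ W x, τ W x + (- u W o) = min (v W x) L := fun W x => by
    rw [hτ, ← min_add_add_right]
    simp [v]
  have hτo : ∀ W, τ W o = - (- u W o) := fun W => by
    rw [hτ, min_eq_left] <;> linarith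
  have hτl : ∀ W x, x ≠ o → N.lap (τ W) x ≤ 0 := by
    intro W x hx
    by_cases hux : u W x ≤ L - (- u W o)
    · refine (N.lap_mono (g := u W) ?_ fun y => ?_).trans (hu2 W x hx)
      · rw [hτ, min_eq_left hux]
      · rw [hτ]; exact min_le_left _ _
    · have hc : N.lap (fun _ : V => L - (- u W o)) x = 0 := by simp [lap_eq_s15]
      rw [← hc]
      refine N.lap_mono ?_ fun y => ?_
      · rw [hτ, min_eq_right (not_le.1 hux).le]
      · rw [hτ]; exact min_le_right _ _
  have hτT : ∀ᶠ W in (U : Filter (Finset V)), ∀ x ∈ T,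
      N.lap (τ W) x = if x = o then 1 else 0 := by
    refine hU ((eventually_ge_atTop (T ∪ F.biUnion P)).mono fun W hW x hx => ?_)
    have hvL : ∀ y ∈ F, τ W y = u W y := fun y hy => by
      have h1 : v W y ≤ C y := hCP y _ (hv0 W) (hvo W) fun z hz => hvl W z
        (hW (Finset.mem_union_right _ (Finset.mem_biUnion.2 ⟨y, hy, hz⟩)))
      have h2 : |C y| ≤ ∑ x ∈ F, |C x| :=
        Finset.single_le_sum (f := fun x => |C x|) (fun _ _ => abs_nonneg _) hy
      have h3 := le_abs_self (C y)
      rw [hτ, min_eq_left]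
      simp only [v] at h1
      linarith
    rw [← hu3 W x (Finset.mem_insert_of_mem (hW (Finset.mem_union_left _ hx)))]
    exact N.lap_congr (hvL x (Finset.mem_union_left _ hx)) fun y hy =>
      hvL y (Finset.mem_union_right _ (Finset.mem_biUnion.2 ⟨x, hx, hy⟩))
  have hoT : o ∈ T := by rw [hT, Finsupp.mem_support_iff, hφo]; norm_num
  have hτE : ∀ᶠ W in (U : Filter (Finset V)), N.B (τ W) (τ W) ≤ L := by
    filter_upwards [hτT] with W hW
    have h1 : N.lap (τ W) o = 1 := by simp [hW o hoT]
    have hone : ∑ x ∈ insert o (N.lapF (τ W)).support, N.lap (τ W) x = 0 := by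
      have h2 : pr (N.lapF (τ W)) (fun _ => 1) = 0 := by
        rw [pr_lapF]
        have : N.lap (fun _ => (1:ℝ)) = 0 := by ext x; simp [lap_eq_s15]
        rw [this]; simp [pr_eq]
      rw [pr_eq' _ _ (Finset.subset_insert o _)] at h2
      simpa [lapF_apply] using h2
    rw [B_eq_lapF, ← N.pr_lapF_shift (τ W) (τ W) (- u W o),
      pr_eq' _ _ (Finset.subset_insert o _), ← Finset.sum_neg_distrib]
    calc ∑ x ∈ insert o (N.lapF (τ W)).support, -(N.lapF (τ W) x * (τ W x + (- u W o)))
        ≤ ∑ x ∈ insert o (N.lapF (τ W)).support,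
            ((if x = o then L else 0) - L * N.lap (τ W) x) := by
          refine Finset.sum_le_sum fun x _ => ?_
          rw [lapF_apply, hτv]
          split_ifs with hx
          · rw [hx, h1, hvo, min_eq_left hL]; linarith
          · have h2 := hτl W x hx
            have h3 := min_le_right (v W x) L
            nlinarith
      _ = L := by
          rw [Finset.sum_sub_distrib, ← Finset.mul_sum, hone]
          simp
  have hlimτ : ∀ x, Tendsto (fun W => τ W x + (- u W o)) U (𝓝 (min (w x) L)) := fun x => by
    simp only [hτv]
    exact (hlim x).min tendsto_const_nhds
  obtain ⟨k, hk⟩ := exists_nat_gt (max L 1)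
  have hkL : L < k := (le_max_left _ _).trans_lt hk
  have hk1 : (1:ℝ) < k := (le_max_right _ _).trans_lt hk
  obtain ⟨s, _, hs2, _, hs4⟩ := N.energy_step o M L T w hw U τ (fun W => - u W o) hu4 hτo hτl
    hτT hτE hlimτ hL hM.le k
  have hBs : N.B φ s = - k := by
    rw [B, pr_eq]
    congr 1
    rw [← hT]
    calc ∑ x ∈ T, φ x * N.lap s x = ∑ x ∈ T, if x = o then φ x * k else 0 := by
          refine Finset.sum_congr rfl fun x hx => ?_
          rw [hs2 x hx]; split_ifs <;> simp
      _ = k := by simp [hoT, hφo]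
  have hcs := N.B_cauchy φ s
  rw [hBs] at hcs
  have hs5 : N.B s s ≤ (k:ℝ) ^ 2 * (M + 2) := by nlinarith
  have h6 : N.B φ φ * N.B s s ≤ N.B φ φ * ((k:ℝ) ^ 2 * (M + 2)) :=
    mul_le_mul_of_nonneg_left hs5 (N.B_nonneg φ)
  have h7 : N.B φ φ * (M + 2) < 1 := by
    rwa [lt_div_iff₀ (by positivity)] at hφE
  have h8 : (0:ℝ) < (k:ℝ) ^ 2 := by positivity
  nlinarith

end Aux

end Network

/-- On every recurrent rooted network there exists a potential tending to
infinity: all its level sets are finite. -/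
theorem exists_potential_tending_to_infinity {V : Type*} (N : Network V)
    (hrec : N.Recurrent) (o : V) :
    ∃ h : V → ℝ, N.IsPotential o h ∧ ∀ M : ℝ, 0 < M → {v : V | h v ≤ M}.Finite := by
  choose H W hH hHW using fun k : ℕ => N.exists_large hrec o (4 ^ (k + 1)) (by positivity)
  choose C P hCP using N.harnack o
  have hbd : ∀ k v, H k v ≤ C v := fun k v =>
    hCP v (H k) (hH k).1 (hH k).2.1 fun x _ => (hH k).lap_ite x
  have hgeo : HasSum (fun k : ℕ => (1 / 2 : ℝ) ^ (k + 1)) 1 := by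
    have := (hasSum_geometric_two).mul_left (1 / 2 : ℝ)
    have e1 : (fun k : ℕ => (1 / 2 : ℝ) ^ (k + 1)) = fun k => 1 / 2 * (1 / 2) ^ k := by
      ext k; rw [pow_succ]; ring
    have e2 : (1 / 2 * 2 : ℝ) = 1 := by norm_num
    rw [e1]
    rwa [e2] at this
  have hnn : ∀ v k, 0 ≤ (1 / 2 : ℝ) ^ (k + 1) * H k v := fun v k =>
    mul_nonneg (by positivity) ((hH k).1 v)
  have hsum : ∀ v, Summable fun k : ℕ => (1 / 2 : ℝ) ^ (k + 1) * H k v := fun v =>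
    Summable.of_nonneg_of_le (hnn v)
      (fun k => mul_le_mul_of_nonneg_left (hbd k v) (by positivity))
      (hgeo.summable.mul_right (C v))
  refine ⟨fun v => ∑' k : ℕ, (1 / 2 : ℝ) ^ (k + 1) * H k v, ?_, ?_⟩
  · refine N.isPotential_of (fun x => tsum_nonneg (hnn x)) ?_ fun x => ?_
    · simp [fun k => (hH k).2.1]
    · have h1 : HasSum (fun k : ℕ => (1 / 2 : ℝ) ^ (k + 1) * N.lap (H k) x)
          (N.lap (fun v => ∑' k : ℕ, (1 / 2 : ℝ) ^ (k + 1) * H k v) x) := by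
        simp only [N.lap_eq_s15]
        have h2 := hasSum_sum (s := N.nb x) fun y _ =>
          (((hsum y).hasSum.sub (hsum x).hasSum).mul_left (N.c x y))
        refine h2.congr_fun fun k => ?_
        rw [Finset.mul_sum]
        exact Finset.sum_congr rfl fun y _ => by ring
      have h3 : HasSum (fun k : ℕ => (1 / 2 : ℝ) ^ (k + 1) * N.lap (H k) x)
          (1 * if x = o then 1 else 0) := by
        simp only [fun k => (hH k).lap_ite x]
        exact hgeo.mul_right _
      rw [h1.unique h3, one_mul]
  · intro M _
    obtain ⟨k, hk⟩ := pow_unbounded_of_one_lt M (one_lt_two : (1:ℝ) < 2)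
    refine (W k).finite_toSet.subset fun v hv => ?_
    by_contra hvW
    have h1 := hHW k v hvW
    have h2 : (1 / 2 : ℝ) ^ (k + 1) * H k v ≤ ∑' k : ℕ, (1 / 2 : ℝ) ^ (k + 1) * H k v :=
      (hsum v).le_tsum k fun j _ => hnn v j
    have h3 : (1 / 2 : ℝ) ^ (k + 1) * 4 ^ (k + 1) ≤ (1 / 2 : ℝ) ^ (k + 1) * H k v :=
      mul_le_mul_of_nonneg_left h1 (by positivity)
    have h4 : (1 / 2 : ℝ) ^ (k + 1) * 4 ^ (k + 1) = 2 ^ (k + 1) := by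
      rw [← mul_pow]; norm_num
    have h5 : (2:ℝ) ^ k ≤ 2 ^ (k + 1) := pow_le_pow_right₀ one_le_two (Nat.le_succ k)
    have h6 : ∑' k : ℕ, (1 / 2 : ℝ) ^ (k + 1) * H k v ≤ M := hv
    linarith
end
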